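/- arXiv:2003.12825 — 8 statements merged into one kernel-verified Lean document; each statement's English description precedes it below -/
import Mathlib

section
/- Let T > 0 and r > 0, and let 𝓑_r := { f ∈ L²[0,T] : ‖f‖₂ ≤ r } be the closed ball of radius r in L²[0,T], endowed with the weak topology of L²[0,T]. Then the map f ↦ (t ↦ ∫₀^t f(s) ds) is continuous from 𝓑_r into C[0,T] with the supremum norm. -/
open MeasureTheory Set

lemma aux_cont (T : ℝ) : Continuous (fun t : ℝ =>
    indicatorConstLp (μ := volume.restrict (Icc (0:ℝ) T)) 2
      (measurableSet_Icc : MeasurableSet (Icc (0:ℝ) t)) (measure_ne_top _ _) (1:ℝ)) := by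
  rw [continuous_iff_continuousAt]
  intro t
  apply tendsto_indicatorConstLp_set (by norm_num)
  have h : Filter.Tendsto (fun y : ℝ => ENNReal.ofReal |t - y|) (nhds t) (nhds 0) := by
    have : Continuous (fun y : ℝ => ENNReal.ofReal |t - y|) :=
      ENNReal.continuous_ofReal.comp (by fun_prop)
    simpa using this.tendsto t
  refine tendsto_of_tendsto_of_tendsto_of_le_of_le tendsto_const_nhds h (fun _ => zero_le) ?_
  intro y
  calc _ ≤ volume (symmDiff (Icc 0 y) (Icc 0 t)) := Measure.restrict_apply_le _ _
    _ ≤ volume (uIcc y t) := by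
      apply measure_mono
      intro x hx
      rw [mem_uIcc]
      simp only [mem_symmDiff, mem_Icc, not_and, not_le] at hx
      rcases hx with ⟨h1, h2⟩ | ⟨h1, h2⟩
      · exact Or.inr ⟨(h2 h1.1).le, h1.2⟩
      · exact Or.inl ⟨(h2 h1.1).le, h1.2⟩
    _ = _ := by rw [Real.volume_interval]

/-- the map `f ↦ (t ↦ ∫₀^t f)` is continuous from the closed ball of radius
`r` in `L²[0,T]`, endowed with the weak topology, into `C[0,T]` with the supremum norm
(realized as the topology of uniform convergence on `[0,T]`). -/
theorem indefinite_integral_weakly_continuous_on_ball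
    (T : ℝ) (hT : 0 < T) (r : ℝ) (hr : 0 < r) :
    ContinuousOn
      (fun f : WeakSpace ℝ (Lp ℝ 2 (volume.restrict (Icc (0:ℝ) T))) =>
        UniformOnFun.ofFun {Icc (0:ℝ) T}
          (fun t : ℝ =>
            ∫ s in Icc (0:ℝ) t,
              (show Lp ℝ 2 (volume.restrict (Icc (0:ℝ) T)) from f) s
                ∂(volume.restrict (Icc (0:ℝ) T))))
      {f : WeakSpace ℝ (Lp ℝ 2 (volume.restrict (Icc (0:ℝ) T))) |
        ‖(show Lp ℝ 2 (volume.restrict (Icc (0:ℝ) T)) from f)‖ ≤ r} := by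
  have hg := aux_cont T
  set g := fun t : ℝ =>
    indicatorConstLp (μ := volume.restrict (Icc (0:ℝ) T)) 2
      (measurableSet_Icc : MeasurableSet (Icc (0:ℝ) t)) (measure_ne_top _ _) (1:ℝ) with hgdef
  have key : ∀ (t : ℝ) (f : Lp ℝ 2 (volume.restrict (Icc (0:ℝ) T))),
      ∫ s in Icc (0:ℝ) t, f s ∂(volume.restrict (Icc (0:ℝ) T)) = inner ℝ (g t) f :=
    fun t f => (L2.inner_indicatorConstLp_one measurableSet_Icc _ f).symm
  intro f₀ hf₀
  rw [ContinuousWithinAt, UniformOnFun.tendsto_iff_tendstoUniformlyOn]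
  rintro K rfl
  rw [← tendstoLocallyUniformlyOn_iff_tendstoUniformlyOn_of_compact isCompact_Icc,
    Metric.tendstoLocallyUniformlyOn_iff]
  intro ε hε t _
  have hδ : 0 < ε / (4 * r) := by positivity
  refine ⟨{y | dist (g y) (g t) < ε / (4 * r)}, mem_nhdsWithin_of_mem_nhds
    (hg.continuousAt (Metric.ball_mem_nhds _ hδ)), ?_⟩
  have hw : Continuous (fun f : WeakSpace ℝ (Lp ℝ 2 (volume.restrict (Icc (0:ℝ) T))) =>
      (inner ℝ (g t) (show Lp ℝ 2 (volume.restrict (Icc (0:ℝ) T)) from f) : ℝ)) :=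
    WeakBilin.eval_continuous (topDualPairing ℝ (Lp ℝ 2 (volume.restrict (Icc (0:ℝ) T)))).flip
      (innerSL ℝ (g t))
  have h1 := hw.continuousAt (x := f₀) (Metric.ball_mem_nhds _ (half_pos hε))
  filter_upwards [self_mem_nhdsWithin, mem_nhdsWithin_of_mem_nhds h1] with f hf hf1 y hy
  change dist (g y) (g t) < ε / (4 * r) at hy
  have main : ∀ a b : Lp ℝ 2 (volume.restrict (Icc (0:ℝ) T)), ‖a‖ ≤ r → ‖b‖ ≤ r →
      dist (inner ℝ (g t) a) (inner ℝ (g t) b) < ε / 2 →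
      dist (∫ s in Icc (0:ℝ) y, b s ∂(volume.restrict (Icc (0:ℝ) T)))
        (∫ s in Icc (0:ℝ) y, a s ∂(volume.restrict (Icc (0:ℝ) T))) < ε := by
    intro a b hf hf₀ hf1
    rw [key, key]
    rw [Real.dist_eq, ← inner_sub_right] at hf1 ⊢
    rw [dist_eq_norm] at hy
    have e : inner ℝ (g y) (b - a) = inner ℝ (g y - g t) (b - a) - inner ℝ (g t) (a - b) := by
      simp only [inner_sub_left, inner_sub_right]; ring
    have hn : ‖b - a‖ ≤ 2 * r := (norm_sub_le _ _).trans (by linarith)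
    have h2 : |inner ℝ (g y - g t) (b - a)| ≤ ε / (4 * r) * (2 * r) :=
      (abs_real_inner_le_norm _ _).trans (mul_le_mul hy.le hn (norm_nonneg _) hδ.le)
    have h3 : ε / (4 * r) * (2 * r) = ε / 2 := by field_simp; norm_num
    rw [e]
    refine (abs_sub _ _).trans_lt ?_
    linarith
  exact main f f₀ hf hf₀ hf1
end

section
/- Let T > 0, let K satisfy Assumption (K) with constants c > 0 and r > 0, and let U : ℝ → [0,∞) be continuous. Then the mapping f ↦ f̂ is continuous from C[0,T] (with the supremum norm) into itself. -/
open MeasureTheory Set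

/-- `f̂(t) = ∫₀^t K(t,s) U(f(s)) ds`. -/
noncomputable def fhat (K : ℝ → ℝ → ℝ) (U : ℝ → ℝ) (f : ℝ → ℝ) (t : ℝ) : ℝ :=
  ∫ s in Icc (0:ℝ) t, K t s * U (f s)

lemma cs_aux (T : ℝ) (hT : 0 < T) (k : ℝ → ℝ) (hk : Measurable k)
    (hi : IntegrableOn (fun s => (k s)^2) (Icc (0:ℝ) T)) :
    IntegrableOn k (Icc (0:ℝ) T) ∧
    (∫ s in Icc (0:ℝ) T, |k s|) ≤ Real.sqrt (T * ∫ s in Icc (0:ℝ) T, (k s)^2) := by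
  have hk1 : IntegrableOn k (Icc (0:ℝ) T) := by
    have h1 : IntegrableOn (fun s => 1 + (k s)^2) (Icc (0:ℝ) T) :=
      (integrable_const (1:ℝ)).add hi
    refine Integrable.mono' h1 hk.aestronglyMeasurable (Filter.Eventually.of_forall fun s => ?_)
    rw [Real.norm_eq_abs]
    nlinarith [sq_abs (k s), sq_nonneg (|k s| - 1), sq_nonneg (|k s|)]
  refine ⟨hk1, ?_⟩
  apply Real.le_sqrt_of_sq_le
  set A := ∫ s in Icc (0:ℝ) T, |k s| with hA
  have h0 : 0 ≤ ∫ s in Icc (0:ℝ) T, (T * |k s| - A)^2 := integral_nonneg fun s => sq_nonneg _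
  have h2 : ∫ s in Icc (0:ℝ) T, (T * |k s| - A)^2
      = T^2 * (∫ s in Icc (0:ℝ) T, (k s)^2) - 2 * T * A * A + A^2 * T := by
    have e : ∀ s, (T * |k s| - A)^2 = T^2 * (k s)^2 - 2 * T * A * |k s| + A^2 := by
      intro s
      rw [← sq_abs (k s)]; ring
    simp_rw [e]
    have i1 : IntegrableOn (fun s => T^2 * (k s)^2) (Icc (0:ℝ) T) := hi.const_mul _
    have i2 : IntegrableOn (fun s => 2 * T * A * |k s|) (Icc (0:ℝ) T) := hk1.abs.const_mul _
    have i3 : IntegrableOn (fun s => T^2 * (k s)^2 - 2 * T * A * |k s|) (Icc (0:ℝ) T) := i1.sub i2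
    rw [integral_add i3 (integrable_const _), integral_sub i1 i2,
      integral_const_mul, integral_const_mul, ← hA]
    simp [hT.le, mul_comm]
  rw [h2] at h0
  have : 0 ≤ T * (T * (∫ s in Icc (0:ℝ) T, (k s)^2) - A^2) := by nlinarith
  have := nonneg_of_mul_nonneg_right this hT
  linarith

lemma cs_bound (T : ℝ) (hT : 0 < T) (k h : ℝ → ℝ) (hk : Measurable k)
    (hi : IntegrableOn (fun s => (k s)^2) (Icc (0:ℝ) T)) (B : ℝ) (hB : 0 ≤ B)
    (hb : ∀ s ∈ Icc (0:ℝ) T, |h s| ≤ B) :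
    |∫ s in Icc (0:ℝ) T, k s * h s| ≤ B * Real.sqrt (T * ∫ s in Icc (0:ℝ) T, (k s)^2) := by
  obtain ⟨hk1, hk2⟩ := cs_aux T hT k hk hi
  calc |∫ s in Icc (0:ℝ) T, k s * h s| ≤ ∫ s in Icc (0:ℝ) T, B * |k s| := by
        rw [← Real.norm_eq_abs]
        refine norm_integral_le_of_norm_le (hk1.abs.const_mul B) ?_
        refine (ae_restrict_iff' measurableSet_Icc).2 (Filter.Eventually.of_forall fun s hs => ?_)
        rw [norm_mul, Real.norm_eq_abs, Real.norm_eq_abs, mul_comm]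
        exact mul_le_mul_of_nonneg_right (hb s hs) (abs_nonneg _)
    _ = B * ∫ s in Icc (0:ℝ) T, |k s| := integral_const_mul _ _
    _ ≤ _ := mul_le_mul_of_nonneg_left hk2 hB

lemma fhat_eq_aux (T : ℝ) (K : ℝ → ℝ → ℝ) (U f : ℝ → ℝ)
    (hKvolterra : ∀ t s : ℝ, 0 ≤ t → t < s → s ≤ T → K t s = 0)
    (t : ℝ) (ht : t ∈ Icc (0:ℝ) T) :
    fhat K U f t = ∫ s in Icc (0:ℝ) T, K t s * U (f s) := by
  unfold fhat
  symm
  apply setIntegral_eq_of_subset_of_forall_sdiff_eq_zero measurableSet_Icc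
    (Icc_subset_Icc_right ht.2)
  rintro s ⟨hs, hn⟩
  have : t < s := by
    by_contra h
    exact hn ⟨hs.1, not_lt.1 h⟩
  rw [hKvolterra t s ht.1 this hs.2, zero_mul]

/-- the mapping `f ↦ f̂` is continuous from `C[0,T]` (with the supremum
norm) into itself: it maps continuous functions to continuous functions, and it is
(ε-δ) continuous with respect to the supremum distance. -/
theorem fhat_map_continuous
    (T : ℝ) (hT : 0 < T)
    (K : ℝ → ℝ → ℝ) (c r : ℝ) (hc : 0 < c) (hr : 0 < r)
    (hKmeas : Measurable (Function.uncurry K))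
    (hKint : ∀ t ∈ Icc (0:ℝ) T, IntegrableOn (fun s => (K t s)^2) (Icc (0:ℝ) T))
    (hKbdd : BddAbove ((fun t => ∫ s in Icc (0:ℝ) T, (K t s)^2) '' Icc (0:ℝ) T))
    (hKmoc : ∀ t₁ ∈ Icc (0:ℝ) T, ∀ t₂ ∈ Icc (0:ℝ) T,
      (∫ s in Icc (0:ℝ) T, (K t₁ s - K t₂ s)^2) ≤ c * |t₁ - t₂| ^ r)
    (hKvolterra : ∀ t s : ℝ, 0 ≤ t → t < s → s ≤ T → K t s = 0)
    (U : ℝ → ℝ) (hUcont : Continuous U) (hUnonneg : ∀ x, 0 ≤ U x) :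
    (∀ f : ℝ → ℝ, ContinuousOn f (Icc (0:ℝ) T) →
      ContinuousOn (fhat K U f) (Icc (0:ℝ) T)) ∧
    (∀ f : ℝ → ℝ, ContinuousOn f (Icc (0:ℝ) T) →
      ∀ ε : ℝ, 0 < ε → ∃ δ : ℝ, 0 < δ ∧
        ∀ g : ℝ → ℝ, ContinuousOn g (Icc (0:ℝ) T) →
          (∀ s ∈ Icc (0:ℝ) T, |f s - g s| ≤ δ) →
          ∀ t ∈ Icc (0:ℝ) T, |fhat K U f t - fhat K U g t| ≤ ε) := by
  have hm : ∀ t, Measurable (K t) := fun t => hKmeas.of_uncurry_left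
  have hint : ∀ f : ℝ → ℝ, ContinuousOn f (Icc (0:ℝ) T) → ∀ t ∈ Icc (0:ℝ) T,
      IntegrableOn (fun s => K t s * U (f s)) (Icc (0:ℝ) T) := by
    intro f hf t ht
    exact (cs_aux T hT _ (hm t) (hKint t ht)).1.mul_continuousOn
      (hUcont.comp_continuousOn hf) isCompact_Icc
  constructor
  · intro f hf
    obtain ⟨B, hB⟩ := isCompact_Icc.exists_bound_of_continuousOn (hUcont.comp_continuousOn hf)
    have hB0 : 0 ≤ B := (norm_nonneg _).trans (hB 0 ⟨le_rfl, hT.le⟩)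
    have key : ∀ t₁ ∈ Icc (0:ℝ) T, ∀ t₂ ∈ Icc (0:ℝ) T,
        |fhat K U f t₁ - fhat K U f t₂| ≤ B * Real.sqrt (T * (c * |t₁ - t₂| ^ r)) := by
      intro t₁ h₁ t₂ h₂
      rw [fhat_eq_aux T K U f hKvolterra t₁ h₁, fhat_eq_aux T K U f hKvolterra t₂ h₂,
        ← integral_sub (hint f hf t₁ h₁) (hint f hf t₂ h₂)]
      simp_rw [← sub_mul]
      have hi : IntegrableOn (fun s => (K t₁ s - K t₂ s)^2) (Icc (0:ℝ) T) := by
        refine Integrable.mono' (((hKint t₁ h₁).const_mul 2).add ((hKint t₂ h₂).const_mul 2))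
          (((hm t₁).sub (hm t₂)).pow_const 2).aestronglyMeasurable
          (Filter.Eventually.of_forall fun s => ?_)
        rw [Real.norm_eq_abs, abs_of_nonneg (sq_nonneg _)]
        simp only [Pi.add_apply]
        nlinarith [sq_nonneg (K t₁ s + K t₂ s)]
      refine (cs_bound T hT (fun s => K t₁ s - K t₂ s) (fun s => U (f s))
        ((hm t₁).sub (hm t₂)) hi B hB0 hB).trans ?_
      gcongr
      exact hKmoc t₁ h₁ t₂ h₂
    intro t₀ h₀
    rw [ContinuousWithinAt, tendsto_iff_dist_tendsto_zero]
    have hc0 : Continuous (fun t : ℝ => B * Real.sqrt (T * (c * |t - t₀| ^ r))) := by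
      have : Continuous (fun t : ℝ => |t - t₀| ^ r) :=
        Continuous.rpow_const (by fun_prop) (fun _ => Or.inr hr.le)
      fun_prop
    have hl := (hc0.tendsto t₀).mono_left (nhdsWithin_le_nhds (s := Icc (0:ℝ) T))
    simp only [sub_self, abs_zero, Real.zero_rpow hr.ne', mul_zero, Real.sqrt_zero] at hl
    refine squeeze_zero' (Filter.Eventually.of_forall fun _ => dist_nonneg) ?_ hl
    filter_upwards [self_mem_nhdsWithin] with t ht
    exact key t ht t₀ h₀
  · intro f hf ε hε
    obtain ⟨C, hC⟩ := hKbdd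
    obtain ⟨R, hR⟩ := isCompact_Icc.exists_bound_of_continuousOn hf
    have hu := (isCompact_Icc (a := -(R+1)) (b := R+1)).uniformContinuousOn_of_continuous
      hUcont.continuousOn
    have hS : 0 < Real.sqrt (T * C) + 1 := by positivity
    rw [Metric.uniformContinuousOn_iff] at hu
    obtain ⟨δ, hδ, hu⟩ := hu (ε / (Real.sqrt (T * C) + 1)) (by positivity)
    refine ⟨min 1 (δ / 2), by positivity, ?_⟩
    intro g hg hfg t ht
    rw [fhat_eq_aux T K U f hKvolterra t ht, fhat_eq_aux T K U g hKvolterra t ht,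
        ← integral_sub (hint f hf t ht) (hint g hg t ht)]
    simp_rw [← mul_sub]
    refine (cs_bound T hT (K t) (fun s => U (f s) - U (g s)) (hm t) (hKint t ht)
      (ε / (Real.sqrt (T * C) + 1)) (by positivity) ?_).trans ?_
    · intro s hs
      have h1 := hfg s hs
      have h2 := h1.trans (min_le_left _ _)
      have h3 := h1.trans (min_le_right _ _)
      have h4 := hR s hs
      rw [Real.norm_eq_abs] at h4
      rw [abs_le] at h2 h4
      exact (hu (f s) ⟨by linarith, by linarith⟩ (g s) ⟨by linarith, by linarith⟩
        (by rw [Real.dist_eq]; linarith)).le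
    · have h5 : (∫ s in Icc (0:ℝ) T, (K t s)^2) ≤ C := hC ⟨t, ht, rfl⟩
      calc _ ≤ ε / (Real.sqrt (T * C) + 1) * (Real.sqrt (T * C) + 1) := by
            refine mul_le_mul_of_nonneg_left ?_ (by positivity)
            have := Real.sqrt_le_sqrt (mul_le_mul_of_nonneg_left h5 hT.le)
            linarith
        _ = ε := div_mul_cancel₀ _ hS.ne'
end

section
/- Let T > 0, v₀ ∈ ℝ, μ > 0, and let b̄, σ̄ : ℝ → ℝ be measurable functions with b̄(x)² ≤ μ²(1 + x²) and σ̄(x)² ≤ μ²(1 + x²) for all x ∈ ℝ. Let g ∈ L²[0,T] and let v : [0,T] → ℝ be a continuous function satisfying v(t) = v₀ + ∫₀^t b̄(v(s)) ds + ∫₀^t σ̄(v(s)) g(s) ds for all t ∈ [0,T]. Then sup_{0 ≤ s ≤ T} v(s)² ≤ (3 v₀² + 6 μ² T² + 6 μ² T ‖g‖₂²) · exp( 6 μ² T (T + ‖g‖₂²) ). -/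
open MeasureTheory Set

/-- Cauchy-Schwarz for real integrals. -/
lemma cs_integral {α : Type*} [MeasurableSpace α] (m : Measure α) (f g : α → ℝ)
    (hf : Integrable (fun x => f x ^ 2) m) (hg : Integrable (fun x => g x ^ 2) m)
    (hfg : Integrable (fun x => f x * g x) m) :
    (∫ x, f x * g x ∂m) ^ 2 ≤ (∫ x, f x ^ 2 ∂m) * ∫ x, g x ^ 2 ∂m := by
  have key : ∀ c : ℝ, 0 ≤ (∫ x, f x ^ 2 ∂m) * (c * c) + (2 * ∫ x, f x * g x ∂m) * c
      + ∫ x, g x ^ 2 ∂m := by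
    intro c
    have h0 : 0 ≤ ∫ x, (c * f x + g x) ^ 2 ∂m := integral_nonneg fun x => sq_nonneg _
    have h1 : ∫ x, (c * f x + g x) ^ 2 ∂m
        = ∫ x, ((c * c) * f x ^ 2 + (2 * c) * (f x * g x)) + g x ^ 2 ∂m := by
      congr 1; ext x; ring
    have ha := hf.const_mul (c * c)
    have hb := hfg.const_mul (2 * c)
    have hab : Integrable (fun x => (c * c) * f x ^ 2 + (2 * c) * (f x * g x)) m := ha.add hb
    rw [h1, integral_add hab hg, integral_add ha hb, integral_const_mul,
      integral_const_mul] at h0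
    linarith
  have := discrim_le_zero key
  unfold discrim at this
  nlinarith

/-- Gronwall in integral form. -/
lemma gronwall_int (T A K : ℝ) (hT : 0 < T) (hA : 0 ≤ A) (hK : 0 ≤ K) (u : ℝ → ℝ)
    (hu : ContinuousOn u (Icc 0 T)) (hu0 : ∀ t, 0 ≤ u t)
    (h : ∀ t ∈ Icc (0:ℝ) T, u t ≤ A + K * ∫ s in Icc (0:ℝ) t, u s) :
    ∀ t ∈ Icc (0:ℝ) T, u t ≤ A * Real.exp (K * t) := by
  set w : ℝ → ℝ := IccExtend hT.le ((Icc 0 T).domRestrict u) with hw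
  have hwc : Continuous w := hu.domRestrict.Icc_extend'
  have hwu : ∀ t ∈ Icc (0:ℝ) T, w t = u t := fun t ht => by
    rw [hw, IccExtend_of_mem _ _ ht]; rfl
  have hI : ∀ t ∈ Icc (0:ℝ) T, ∫ s in Icc (0:ℝ) t, u s = ∫ s in (0:ℝ)..t, w s := by
    intro t ht
    rw [intervalIntegral.integral_of_le ht.1, ← integral_Icc_eq_integral_Ioc]
    exact setIntegral_congr_fun measurableSet_Icc
      fun s hs => (hwu s ⟨hs.1, hs.2.trans ht.2⟩).symm
  have hd : ∀ t, HasDerivAt (fun t => A + K * ∫ s in (0:ℝ)..t, w s) (K * w t) t := fun t =>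
    ((hwc.integral_hasStrictDerivAt 0 t).hasDerivAt.const_mul K).const_add A
  have hle : ∀ t ∈ Icc (0:ℝ) T, u t ≤ A + K * ∫ s in (0:ℝ)..t, w s := fun t ht => by
    rw [← hI t ht]; exact h t ht
  have := norm_le_gronwallBound_of_norm_deriv_right_le (δ := A) (K := K) (ε := 0) (a := 0) (b := T)
    (f := fun t => A + K * ∫ s in (0:ℝ)..t, w s) (f' := fun t => K * w t)
    (fun t _ => (hd t).continuousAt.continuousWithinAt)
    (fun t _ => (hd t).hasDerivWithinAt)
    (by simp [abs_of_nonneg hA])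
    (by
      intro t ht
      have ht' : t ∈ Icc (0:ℝ) T := ⟨ht.1, ht.2.le⟩
      have h1 := hle t ht'
      rw [hwu t ht', Real.norm_of_nonneg (mul_nonneg hK (hu0 t)), add_zero]
      exact mul_le_mul_of_nonneg_left (h1.trans (le_abs_self _)) hK)
  intro t ht
  have h2 := this t ht
  rw [gronwallBound_ε0, sub_zero] at h2
  exact (hle t ht).trans ((le_abs_self _).trans h2)

/-- a priori (Gronwall-type) bound for continuous solutions of the
controlled equation `v(t) = v₀ + ∫₀^t b̄(v(s)) ds + ∫₀^t σ̄(v(s)) g(s) ds` under the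
sub-linear growth conditions `b̄(x)² ≤ μ²(1+x²)`, `σ̄(x)² ≤ μ²(1+x²)`. -/
theorem controlled_ode_sup_bound
    (T : ℝ) (hT : 0 < T) (v₀ μ : ℝ) (hμ : 0 < μ)
    (bb sb : ℝ → ℝ) (hbmeas : Measurable bb) (hsmeas : Measurable sb)
    (hbgrow : ∀ x : ℝ, (bb x)^2 ≤ μ^2 * (1 + x^2))
    (hsgrow : ∀ x : ℝ, (sb x)^2 ≤ μ^2 * (1 + x^2))
    (g : ℝ → ℝ) (hgmeas : Measurable g)
    (hgL2 : IntegrableOn (fun s => (g s)^2) (Icc (0:ℝ) T))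
    (v : ℝ → ℝ) (hv : ContinuousOn v (Icc (0:ℝ) T))
    (hbint : IntegrableOn (fun s => bb (v s)) (Icc (0:ℝ) T))
    (hsint : IntegrableOn (fun s => sb (v s) * g s) (Icc (0:ℝ) T))
    (heq : ∀ t ∈ Icc (0:ℝ) T,
      v t = v₀ + (∫ s in Icc (0:ℝ) t, bb (v s)) + ∫ s in Icc (0:ℝ) t, sb (v s) * g s) :
    ∀ t ∈ Icc (0:ℝ) T,
      (v t)^2 ≤ (3 * v₀^2 + 6 * μ^2 * T^2 + 6 * μ^2 * T * (∫ s in Icc (0:ℝ) T, (g s)^2)) *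
        Real.exp (6 * μ^2 * T * (T + ∫ s in Icc (0:ℝ) T, (g s)^2)) := by
  set G := ∫ s in Icc (0:ℝ) T, (g s)^2 with hG
  have hG0 : 0 ≤ G := integral_nonneg fun s => sq_nonneg _
  have hv2 : ContinuousOn (fun s => (v s)^2) (Icc (0:ℝ) T) := hv.pow 2
  have hv2i : IntegrableOn (fun s => (v s)^2) (Icc (0:ℝ) T) :=
    hv2.integrableOn_compact isCompact_Icc
  have hmaj : IntegrableOn (fun s => μ^2 * (1 + (v s)^2)) (Icc (0:ℝ) T) :=
    (continuousOn_const.mul (continuousOn_const.add hv2)).integrableOn_compact isCompact_Icc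
  have hvm : AEMeasurable v (volume.restrict (Icc (0:ℝ) T)) := hv.aemeasurable measurableSet_Icc
  have hsq : ∀ f : ℝ → ℝ, Measurable f → (∀ x, (f x)^2 ≤ μ^2 * (1 + x^2)) →
      IntegrableOn (fun s => (f (v s))^2) (Icc (0:ℝ) T) := by
    intro f hf hg
    refine Integrable.mono' hmaj ((hf.comp_aemeasurable hvm).pow_const 2).aestronglyMeasurable ?_
    refine Filter.Eventually.of_forall fun s => ?_
    rw [Real.norm_of_nonneg (sq_nonneg _)]
    exact hg _
  have hb2 := hsq bb hbmeas hbgrow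
  have hs2 := hsq sb hsmeas hsgrow
  have hmain : ∀ t ∈ Icc (0:ℝ) T, (v t)^2 ≤ (3 * v₀^2 + 3 * μ^2 * (T + G) * T)
      + (3 * μ^2 * (T + G)) * ∫ s in Icc (0:ℝ) t, (v s)^2 := by
    intro t ht
    have hsub : Icc (0:ℝ) t ⊆ Icc 0 T := Icc_subset_Icc_right ht.2
    set J := ∫ s in Icc (0:ℝ) t, (v s)^2 with hJ
    have hJ0 : 0 ≤ J := integral_nonneg fun s => sq_nonneg _
    have hone : IntegrableOn (fun _ : ℝ => (1:ℝ)) (Icc (0:ℝ) t) :=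
      continuousOn_const.integrableOn_compact isCompact_Icc
    have hone' : ∫ _ in Icc (0:ℝ) t, (1:ℝ) = t := by simp [ht.1]
    have hmajv : ∫ s in Icc (0:ℝ) t, μ^2 * (1 + (v s)^2) = μ^2 * (t + J) := by
      rw [integral_const_mul, integral_add hone (hv2i.mono_set hsub), hone']
    have hB : ∀ f : ℝ → ℝ, (∀ x, (f x)^2 ≤ μ^2 * (1 + x^2)) →
        IntegrableOn (fun s => (f (v s))^2) (Icc (0:ℝ) T) →
        ∫ s in Icc (0:ℝ) t, (f (v s))^2 ≤ μ^2 * (T + J) := by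
      intro f hf hfi
      have h1 : ∫ s in Icc (0:ℝ) t, (f (v s))^2 ≤ ∫ s in Icc (0:ℝ) t, μ^2 * (1 + (v s)^2) :=
        integral_mono (hfi.mono_set hsub) (hmaj.mono_set hsub) fun s => hf _
      rw [hmajv] at h1
      refine h1.trans (mul_le_mul_of_nonneg_left ?_ (sq_nonneg _))
      linarith [ht.2]
    have hGt : ∫ s in Icc (0:ℝ) t, (g s)^2 ≤ G :=
      setIntegral_mono_set hgL2 (Filter.Eventually.of_forall fun s => sq_nonneg _)
        hsub.eventuallyLE
    have c1 := cs_integral (volume.restrict (Icc (0:ℝ) t)) (fun s => bb (v s)) (fun _ => 1)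
      (hb2.mono_set hsub) (by simp) (by simp only [mul_one]; exact hbint.mono_set hsub)
    have c2 := cs_integral (volume.restrict (Icc (0:ℝ) t)) (fun s => sb (v s)) g
      (hs2.mono_set hsub) (hgL2.mono_set hsub) (hsint.mono_set hsub)
    simp only [mul_one, one_pow, hone'] at c1
    have hM : 0 ≤ μ^2 * (T + J) := by positivity
    have d1 := c1.trans (mul_le_mul (hB bb hbgrow hb2) ht.2 ht.1 hM)
    have d2 := c2.trans (mul_le_mul (hB sb hsgrow hs2) hGt
      (integral_nonneg fun s => sq_nonneg _) hM)
    rw [heq t ht]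
    set X := ∫ s in Icc (0:ℝ) t, bb (v s)
    set Y := ∫ s in Icc (0:ℝ) t, sb (v s) * g s
    nlinarith [sq_nonneg (v₀ - X), sq_nonneg (v₀ - Y), sq_nonneg (X - Y)]
  intro t ht
  have hfin := gronwall_int T _ _ hT (by positivity) (by positivity) (fun s => (v s)^2) hv2
    (fun s => sq_nonneg _) hmain t ht
  refine hfin.trans ?_
  have hP : 0 ≤ μ^2 * (T + G) := by positivity
  have hPT : 0 ≤ μ^2 * (T + G) * T := by positivity
  refine mul_le_mul ?_ (Real.exp_le_exp.mpr ?_) (Real.exp_pos _).le (by positivity)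
  · nlinarith
  · nlinarith [mul_le_mul_of_nonneg_left ht.2 hP]
end

section
/- Let T > 0, let K satisfy Assumption (K) with constants c > 0 and r > 0, let U : ℝ → [0,∞) be continuous, let v₀ ∈ ℝ, μ > 0, β > 0, and let b̄, σ̄ : ℝ → ℝ be continuous with b̄(x)² ≤ μ²(1 + x²) and σ̄(x)² ≤ μ²(1 + x²) for all x ∈ ℝ. Define E_β := { v̂ : v ∈ C[0,T] and there exists g ∈ L²[0,T] with ∫₀^T g(s)² ds ≤ β such that v(t) = v₀ + ∫₀^t b̄(v(s)) ds + ∫₀^t σ̄(v(s)) g(s) ds for all t ∈ [0,T] }, where v̂(t) := ∫₀^t K(t,s) U(v(s)) ds. Then E_β is a relatively compact (totally bounded) subset of C[0,T]. -/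
open MeasureTheory Set

/-- `v̂(t) = ∫₀^t K(t,s) U(v(s)) ds`. -/
noncomputable def vhat (K : ℝ → ℝ → ℝ) (U : ℝ → ℝ) (v : ℝ → ℝ) (t : ℝ) : ℝ :=
  ∫ s in Icc (0:ℝ) t, K t s * U (v s)


lemma aux_cs {m : Measure ℝ} {f h : ℝ → ℝ} (hf : MemLp f 2 m) (hh : MemLp h 2 m) :
    (∫ s, f s * h s ∂m)^2 ≤ (∫ s, (f s)^2 ∂m) * (∫ s, (h s)^2 ∂m) := by
  have i1 := hf.integrable_sq
  have i2 := hh.integrable_sq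
  have i3 : Integrable (fun s => f s * h s) m := hf.integrable_mul hh
  have key : ∀ x : ℝ, 0 ≤ (∫ s, (h s)^2 ∂m) * (x * x) + (2 * ∫ s, f s * h s ∂m) * x
      + ∫ s, (f s)^2 ∂m := by
    intro x
    have e : (∫ s, (f s + x * h s)^2 ∂m) = (∫ s, (h s)^2 ∂m) * (x * x)
        + (2 * ∫ s, f s * h s ∂m) * x + ∫ s, (f s)^2 ∂m := by
      have : ∀ s, (f s + x * h s)^2 = (x*x) * (h s)^2 + (2 * x) * (f s * h s) + (f s)^2 := by
        intro s; ring
      simp_rw [this]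
      have i4 : Integrable (fun s => (x*x) * (h s)^2 + (2 * x) * (f s * h s)) m :=
        (i2.const_mul _).add (i3.const_mul _)
      rw [integral_add i4 i1,
        integral_add (i2.const_mul _) (i3.const_mul _), integral_const_mul, integral_const_mul]
      ring
    rw [← e]
    exact integral_nonneg fun s => sq_nonneg _
  have := discrim_le_zero key
  unfold discrim at this
  nlinarith

lemma aux_net (T : ℝ) (hT : 0 < T) (D δ ε : ℝ) (hδ : 0 < δ) (hε : 0 < ε) :
    ∃ F : Finset (ℝ → ℝ), ∀ f : ℝ → ℝ, (∀ t ∈ Icc (0:ℝ) T, |f t| ≤ D) →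
      (∀ s ∈ Icc (0:ℝ) T, ∀ t ∈ Icc (0:ℝ) T, |t - s| ≤ δ → |f t - f s| ≤ ε / 2) →
      ∃ w ∈ F, ∀ t ∈ Icc (0:ℝ) T, |f t - w t| ≤ ε := by
  classical
  obtain ⟨N, hN⟩ := exists_nat_gt (T / δ)
  have hcomp : IsCompact (Set.pi univ fun _ : Fin (N+1) => Icc (-D) D) :=
    isCompact_univ_pi fun _ => isCompact_Icc
  obtain ⟨S, hSf, hS⟩ := Metric.totallyBounded_iff.1 hcomp.totallyBounded (ε/2) (half_pos hε)
  refine ⟨hSf.toFinset.image (fun a t => a (Fin.ofNat (N+1) ⌊t / δ⌋₊)), ?_⟩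
  intro f hfD hfm
  have hTN : ∀ t ∈ Icc (0:ℝ) T, ⌊t / δ⌋₊ < N + 1 := by
    intro t ht
    rw [Nat.floor_lt (div_nonneg ht.1 hδ.le)]
    have : t / δ ≤ T / δ := by gcongr; exact ht.2
    push_cast; linarith
  have hmem : (fun i : Fin (N+1) => f (min (i * δ) T)) ∈
      (Set.pi univ fun _ : Fin (N+1) => Icc (-D) D) := by
    intro i _
    exact abs_le.1 (hfD _ ⟨le_min (by positivity) hT.le, min_le_right _ _⟩)
  obtain ⟨a, ha, hd⟩ := mem_iUnion₂.1 (hS hmem)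
  refine ⟨_, Finset.mem_image_of_mem _ (hSf.mem_toFinset.2 ha), ?_⟩
  intro t ht
  have h0 : 0 ≤ t / δ := div_nonneg ht.1 hδ.le
  have h1 := Nat.floor_le h0
  have h2 := Nat.lt_floor_add_one (t / δ)
  rw [le_div_iff₀ hδ] at h1
  rw [div_lt_iff₀ hδ] at h2
  have hval : ((Fin.ofNat (N+1) ⌊t / δ⌋₊ : Fin (N+1)) : ℕ) = ⌊t / δ⌋₊ := by
    simp [Fin.ofNat, Nat.mod_eq_of_lt (hTN t ht)]
  have h3 : |f (⌊t / δ⌋₊ * δ) - a (Fin.ofNat (N+1) ⌊t / δ⌋₊)| < ε / 2 := by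
    have := (dist_pi_lt_iff (half_pos hε)).1 (Metric.mem_ball.1 hd) (Fin.ofNat (N+1) ⌊t / δ⌋₊)
    rw [Real.dist_eq, hval, min_eq_left (h1.trans ht.2)] at this
    exact this
  have h4 := hfm (⌊t / δ⌋₊ * δ) ⟨by positivity, h1.trans ht.2⟩ t ht
    (by rw [abs_le]; constructor <;> linarith)
  have := abs_sub_le (f t) (f (⌊t / δ⌋₊ * δ)) (a (Fin.ofNat (N+1) ⌊t / δ⌋₊))
  show |f t - a (Fin.ofNat (N+1) ⌊t / δ⌋₊)| ≤ ε
  linarith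

lemma aux_memLp_cont {T : ℝ} {v : ℝ → ℝ} (hv : ContinuousOn v (Icc (0:ℝ) T)) {t : ℝ}
    (ht : t ≤ T) : MemLp v 2 (volume.restrict (Icc (0:ℝ) t)) := by
  have hv' := hv.mono (Icc_subset_Icc_right ht)
  rw [memLp_two_iff_integrable_sq (hv'.aestronglyMeasurable measurableSet_Icc)]
  exact (hv'.pow 2).integrableOn_Icc

lemma aux_gronwall (T : ℝ) (hT : 0 < T) (A B : ℝ) (v : ℝ → ℝ)
    (hv : ContinuousOn v (Icc (0:ℝ) T)) (hA : 0 ≤ A) (hB : 0 ≤ B)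
    (h : ∀ t ∈ Icc (0:ℝ) T, (v t)^2 ≤ A + B * ∫ s in Icc (0:ℝ) t, (v s)^2) :
    ∀ t ∈ Icc (0:ℝ) T, (v t)^2 ≤ A + B * gronwallBound 0 B A T := by
  have hc : ContinuousOn (fun s => (v s)^2) (Icc (0:ℝ) T) := hv.pow 2
  have hint : IntegrableOn (fun s => (v s)^2) (Icc (0:ℝ) T) := hc.integrableOn_Icc
  have hii : ∀ t ∈ Icc (0:ℝ) T, IntervalIntegrable (fun s => (v s)^2) volume 0 t := by
    intro t ht
    rw [intervalIntegrable_iff_integrableOn_Icc_of_le ht.1]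
    exact hint.mono_set (Icc_subset_Icc_right ht.2)
  have heq : ∀ t ∈ Icc (0:ℝ) T, (∫ s in Icc (0:ℝ) t, (v s)^2) = ∫ s in (0:ℝ)..t, (v s)^2 := by
    intro t ht
    rw [intervalIntegral.integral_of_le ht.1, integral_Icc_eq_integral_Ioc]
  have hnn : ∀ t ∈ Icc (0:ℝ) T, 0 ≤ ∫ s in (0:ℝ)..t, (v s)^2 := fun t ht =>
    intervalIntegral.integral_nonneg ht.1 fun s _ => sq_nonneg _
  have hg := norm_le_gronwallBound_of_norm_deriv_right_le
    (f := fun t => ∫ s in (0:ℝ)..t, (v s)^2) (f' := fun t => (v t)^2) (δ := 0) (K := B) (ε := A)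
    (a := 0) (b := T) ?_ ?_ (by simp) ?_
  · intro t ht
    have h1 := hg T (right_mem_Icc.2 hT.le)
    rw [sub_zero, Real.norm_of_nonneg (hnn T (right_mem_Icc.2 hT.le)),
      ← heq T (right_mem_Icc.2 hT.le)] at h1
    have h2 : (∫ s in Icc (0:ℝ) t, (v s)^2) ≤ ∫ s in Icc (0:ℝ) T, (v s)^2 :=
      setIntegral_mono_set hint (Filter.Eventually.of_forall fun s => sq_nonneg _)
        (Icc_subset_Icc_right ht.2).eventuallyLE
    have := mul_le_mul_of_nonneg_left (h2.trans h1) hB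
    linarith [h t ht]
  · have := intervalIntegral.continuousOn_primitive_interval (μ := volume) (a := 0) (b := T)
      (f := fun s => (v s)^2) (by rwa [uIcc_of_le hT.le])
    rwa [uIcc_of_le hT.le] at this
  · intro t ht
    have hcw : ContinuousWithinAt (fun s => (v s)^2) (Ici t) t :=
      (hc t (Ico_subset_Icc_self ht)).mono_of_mem_nhdsWithin (by
        exact Filter.mem_of_superset (Icc_mem_nhdsGE ht.2) (Icc_subset_Icc_left ht.1))
    refine intervalIntegral.integral_hasDerivWithinAt_right (hii t (Ico_subset_Icc_self ht))
      (s := Ici t) (t := Ioi t) ?_ (hcw.mono Ioi_subset_Ici_self)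
    refine ⟨Ioc t T, Ioc_mem_nhdsGT ht.2, ?_⟩
    exact (hc.mono (fun s hs => ⟨ht.1.trans hs.1.le, hs.2⟩)).aestronglyMeasurable measurableSet_Ioc
  · intro t ht
    have ht' := Ico_subset_Icc_self ht
    rw [Real.norm_of_nonneg (sq_nonneg _), Real.norm_of_nonneg (hnn t ht'), ← heq t ht']
    linarith [h t ht']

lemma aux_sq_bound (T : ℝ) (v₀ μ β : ℝ) (hβ : 0 < β)
    (bb sb : ℝ → ℝ) (hbcont : Continuous bb) (hscont : Continuous sb)
    (hbgrow : ∀ x : ℝ, (bb x)^2 ≤ μ^2 * (1 + x^2))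
    (hsgrow : ∀ x : ℝ, (sb x)^2 ≤ μ^2 * (1 + x^2))
    (v g : ℝ → ℝ) (hv : ContinuousOn v (Icc (0:ℝ) T)) (hg : Measurable g)
    (hgi : IntegrableOn (fun s => (g s)^2) (Icc (0:ℝ) T))
    (hgβ : (∫ s in Icc (0:ℝ) T, (g s)^2) ≤ β)
    (heq : ∀ t ∈ Icc (0:ℝ) T,
      v t = v₀ + (∫ s in Icc (0:ℝ) t, bb (v s)) + ∫ s in Icc (0:ℝ) t, sb (v s) * g s) :
    ∀ t ∈ Icc (0:ℝ) T, (v t)^2 ≤ (3 * v₀^2 + 3 * (T + β) * μ^2 * T)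
      + (3 * (T + β) * μ^2) * ∫ s in Icc (0:ℝ) t, (v s)^2 := by
  intro t ht
  have hb : MemLp (fun s => bb (v s)) 2 (volume.restrict (Icc (0:ℝ) t)) :=
    aux_memLp_cont (hbcont.comp_continuousOn hv) ht.2
  have hs : MemLp (fun s => sb (v s)) 2 (volume.restrict (Icc (0:ℝ) t)) :=
    aux_memLp_cont (hscont.comp_continuousOn hv) ht.2
  have hg2 : MemLp g 2 (volume.restrict (Icc (0:ℝ) t)) := by
    rw [memLp_two_iff_integrable_sq hg.aestronglyMeasurable]
    exact hgi.mono_set (Icc_subset_Icc_right ht.2)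
  have h1 : MemLp (fun _ : ℝ => (1:ℝ)) 2 (volume.restrict (Icc (0:ℝ) t)) := memLp_const _
  have hvi := (aux_memLp_cont hv ht.2).integrable_sq
  have cs1 := aux_cs hb h1
  have cs2 := aux_cs hs hg2
  have hvol : (∫ s in Icc (0:ℝ) t, (1:ℝ)^2) = t := by simp [ht.1]
  have hgt : (∫ s in Icc (0:ℝ) t, (g s)^2) ≤ β :=
    (setIntegral_mono_set hgi (Filter.Eventually.of_forall fun s => sq_nonneg _)
        (Icc_subset_Icc_right ht.2).eventuallyLE).trans hgβ
  have hI : (∫ s in Icc (0:ℝ) t, μ^2 * (1 + (v s)^2))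
      = μ^2 * (t + ∫ s in Icc (0:ℝ) t, (v s)^2) := by
    rw [integral_const_mul, integral_add (integrable_const _) hvi]
    simp [ht.1]
  have hIi : Integrable (fun s => μ^2 * (1 + (v s)^2)) (volume.restrict (Icc (0:ℝ) t)) :=
    ((integrable_const _).add hvi).const_mul _
  have hb2 := integral_mono hb.integrable_sq hIi (fun s => hbgrow (v s))
  have hs2 := integral_mono hs.integrable_sq hIi (fun s => hsgrow (v s))
  rw [hI] at hb2 hs2
  simp only [mul_one] at cs1
  rw [hvol] at cs1
  have hvn : 0 ≤ ∫ s in Icc (0:ℝ) t, (v s)^2 := integral_nonneg fun s => sq_nonneg _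
  have hJ : μ^2 * (t + ∫ s in Icc (0:ℝ) t, (v s)^2) ≤
      μ^2 * (T + ∫ s in Icc (0:ℝ) t, (v s)^2) := by gcongr; exact ht.2
  have hT0 : 0 ≤ T := ht.1.trans ht.2
  have hJ0 : 0 ≤ μ^2 * (T + ∫ s in Icc (0:ℝ) t, (v s)^2) := by positivity
  have e1 := cs1.trans (mul_le_mul (hb2.trans hJ) ht.2 ht.1 hJ0)
  have e2 := cs2.trans (mul_le_mul (hs2.trans hJ) hgt (integral_nonneg fun s => sq_nonneg _) hJ0)
  rw [heq t ht]
  generalize (∫ s in Icc (0:ℝ) t, bb (v s)) = x at *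
  generalize (∫ s in Icc (0:ℝ) t, sb (v s) * g s) = y at *
  nlinarith [sq_nonneg (v₀ - x), sq_nonneg (v₀ - y), sq_nonneg (x - y)]

/-- the set `E_β = { v̂ : v solves the controlled equation for some control
`g` with `∫₀^T g² ≤ β` }` is relatively compact (totally bounded) in `C[0,T]`:
for every `ε > 0` there is a finite `ε`-net for `E_β` in the supremum distance. -/
theorem E_beta_relatively_compact
    (T : ℝ) (hT : 0 < T)
    (K : ℝ → ℝ → ℝ) (c r : ℝ) (hc : 0 < c) (hr : 0 < r)
    (hKmeas : Measurable (Function.uncurry K))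
    (hKint : ∀ t ∈ Icc (0:ℝ) T, IntegrableOn (fun s => (K t s)^2) (Icc (0:ℝ) T))
    (CK : ℝ) (hKbdd : ∀ t ∈ Icc (0:ℝ) T, (∫ s in Icc (0:ℝ) T, (K t s)^2) ≤ CK)
    (hKmoc : ∀ t₁ ∈ Icc (0:ℝ) T, ∀ t₂ ∈ Icc (0:ℝ) T,
      (∫ s in Icc (0:ℝ) T, (K t₁ s - K t₂ s)^2) ≤ c * |t₁ - t₂| ^ r)
    (hKvolterra : ∀ t s : ℝ, 0 ≤ t → t < s → s ≤ T → K t s = 0)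
    (U : ℝ → ℝ) (hUcont : Continuous U) (hUnonneg : ∀ x, 0 ≤ U x)
    (v₀ μ β : ℝ) (hμ : 0 < μ) (hβ : 0 < β)
    (bb sb : ℝ → ℝ) (hbcont : Continuous bb) (hscont : Continuous sb)
    (hbgrow : ∀ x : ℝ, (bb x)^2 ≤ μ^2 * (1 + x^2))
    (hsgrow : ∀ x : ℝ, (sb x)^2 ≤ μ^2 * (1 + x^2)) :
    ∀ ε : ℝ, 0 < ε →
      ∃ F : Finset (ℝ → ℝ),
        ∀ v g : ℝ → ℝ, ContinuousOn v (Icc (0:ℝ) T) → Measurable g →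
          IntegrableOn (fun s => (g s)^2) (Icc (0:ℝ) T) →
          (∫ s in Icc (0:ℝ) T, (g s)^2) ≤ β →
          (∀ t ∈ Icc (0:ℝ) T,
            v t = v₀ + (∫ s in Icc (0:ℝ) t, bb (v s)) + ∫ s in Icc (0:ℝ) t, sb (v s) * g s) →
          ∃ w ∈ F, ∀ t ∈ Icc (0:ℝ) T, |vhat K U v t - w t| ≤ ε := by
  intro ε hε
  set A := 3 * v₀^2 + 3 * (T + β) * μ^2 * T with hA
  set B := 3 * (T + β) * μ^2 with hB
  have hA0 : 0 ≤ A := by positivity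
  have hB0 : 0 ≤ B := by positivity
  set R := √(A + B * gronwallBound 0 B A T) with hR
  obtain ⟨M₀, hM₀⟩ := (isCompact_Icc (a := -R) (b := R)).exists_bound_of_continuousOn
    hUcont.continuousOn
  set M := max M₀ 1 with hM
  have hMpos : 0 < M := lt_max_of_lt_right one_pos
  have hlim : ∃ δ > 0, ∀ h : ℝ, 0 ≤ h → h ≤ δ → c * h ^ r * (T * M^2) ≤ (ε/2)^2 := by
    have hk : 0 < c * (T * M^2) := by positivity
    refine ⟨((ε/2)^2 / (c * (T * M^2))) ^ (1/r), by positivity, fun h h0 h1 => ?_⟩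
    have h2 := Real.rpow_le_rpow h0 h1 hr.le
    rw [← Real.rpow_mul (by positivity), one_div_mul_cancel hr.ne', Real.rpow_one,
      le_div_iff₀ hk] at h2
    linarith
  obtain ⟨δ, hδ, hδm⟩ := hlim
  obtain ⟨F, hF⟩ := aux_net T hT (√(CK * (T * M^2))) δ ε hδ hε
  refine ⟨F, fun v g hv hg hgi hgβ heq => ?_⟩
  have hvR := aux_gronwall T hT A B v hv hA0 hB0
    (aux_sq_bound T v₀ μ β hβ bb sb hbcont hscont hbgrow hsgrow v g hv hg hgi hgβ heq)
  have hUM : ∀ t ∈ Icc (0:ℝ) T, (U (v t))^2 ≤ M^2 := by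
    intro t ht
    have h1 := hM₀ (v t) (abs_le.1 (Real.abs_le_sqrt (hvR t ht)))
    rw [Real.norm_eq_abs] at h1
    exact sq_le_sq' (by linarith [(abs_le.1 h1).1, le_max_left M₀ 1])
      ((le_abs_self _).trans (h1.trans (le_max_left _ _)))
  have hUm : MemLp (fun s => U (v s)) 2 (volume.restrict (Icc (0:ℝ) T)) :=
    aux_memLp_cont (hUcont.comp_continuousOn hv) le_rfl
  have hUI : (∫ s in Icc (0:ℝ) T, (U (v s))^2) ≤ T * M^2 := by
    have := setIntegral_mono_on hUm.integrable_sq (integrable_const (M^2)) measurableSet_Icc hUM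
    simpa [hT.le] using this
  have hKm : ∀ t ∈ Icc (0:ℝ) T, MemLp (K t) 2 (volume.restrict (Icc (0:ℝ) T)) := by
    intro t ht
    have hm : Measurable (K t) := hKmeas.comp measurable_prodMk_left
    rw [memLp_two_iff_integrable_sq hm.aestronglyMeasurable]
    exact hKint t ht
  have hvh : ∀ t ∈ Icc (0:ℝ) T, vhat K U v t = ∫ s in Icc (0:ℝ) T, K t s * U (v s) := by
    intro t ht
    unfold vhat
    refine (setIntegral_eq_of_subset_of_forall_sdiff_eq_zero measurableSet_Icc
      (Icc_subset_Icc_right ht.2) ?_).symm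
    intro s hs
    have : t < s := by
      by_contra hcon
      exact hs.2 ⟨hs.1.1, not_lt.1 hcon⟩
    rw [hKvolterra t s ht.1 this hs.1.2, zero_mul]
  have hUI0 : 0 ≤ ∫ s in Icc (0:ℝ) T, (U (v s))^2 := integral_nonneg fun s => sq_nonneg _
  refine hF _ (fun t ht => ?_) (fun s hs t ht hst => ?_)
  · rw [hvh t ht]
    have hCK0 : 0 ≤ CK := (integral_nonneg fun s => sq_nonneg _).trans (hKbdd t ht)
    exact Real.abs_le_sqrt ((aux_cs (hKm t ht) hUm).trans
      (mul_le_mul (hKbdd t ht) hUI hUI0 hCK0))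
  · have hi : ∀ u ∈ Icc (0:ℝ) T,
        Integrable (fun s => K u s * U (v s)) (volume.restrict (Icc (0:ℝ) T)) :=
      fun u hu => (hKm u hu).integrable_mul hUm
    rw [hvh t ht, hvh s hs, ← integral_sub (hi t ht) (hi s hs)]
    have hcs := aux_cs ((hKm t ht).sub (hKm s hs)) hUm
    have h1 := mul_le_mul (hKmoc t ht s hs) hUI hUI0 (by positivity)
    have h2 := hδm |t - s| (abs_nonneg _) hst
    refine abs_le_of_sq_le_sq ?_ (by positivity)
    simp only [Pi.sub_apply, sub_mul] at hcs
    exact hcs.trans (h1.trans h2)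
end

section
/- Let T > 0 and let b̄, σ̄ satisfy Assumption (R) with fixed v₀ > 0. Then for every f ∈ L²[0,T] there exists exactly one continuous function v : [0,T] → ℝ satisfying v(t) = v₀ + ∫₀^t b̄(v(s)) ds + ∫₀^t σ̄(v(s)) f(s) ds for all t ∈ [0,T]. -/
open MeasureTheory Set

lemma controlled_ode_chain {Φ φ : ℝ → ℝ} (hΦ : ∀ x, HasDerivAt Φ (φ x) x) (hφ : Continuous φ)
    {g u : ℝ → ℝ} {t u0 : ℝ} (ht : 0 ≤ t) (hg : IntervalIntegrable g volume 0 t)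
    (hu : ∀ s ∈ Icc (0:ℝ) t, u s = u0 + ∫ r in (0:ℝ)..s, g r) :
    ∫ s in (0:ℝ)..t, φ (u s) * g s = Φ (u t) - Φ u0 := by
  set U : ℝ → ℝ := fun s => u0 + ∫ r in (0:ℝ)..s, g r with hU
  have hUac : AbsolutelyContinuousOnInterval U 0 t := by
    have h1 := hg.absolutelyContinuousOnInterval_intervalIntegral (c := 0) (by simp)
    have h2 : AbsolutelyContinuousOnInterval (fun _ : ℝ => u0) 0 t :=
      (LipschitzWith.const (α := ℝ) u0).lipschitzOnWith.absolutelyContinuousOnInterval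
    exact h2.add h1
  have hUc := hUac.continuousOn
  obtain ⟨m, hm⟩ : ∃ m, ∀ s ∈ uIcc 0 t, |U s| ≤ m := by
    obtain ⟨m, hm⟩ := isCompact_uIcc.exists_bound_of_continuousOn hUc
    exact ⟨m, fun s hs => by simpa using hm s hs⟩
  have hC1 : ContDiff ℝ 1 Φ := by
    rw [contDiff_one_iff_deriv]
    refine ⟨fun x => (hΦ x).differentiableAt, ?_⟩
    have : deriv Φ = φ := funext fun x => (hΦ x).deriv
    rwa [this]
  obtain ⟨K, hK⟩ := hC1.contDiffOn.exists_lipschitzOnWith (s := Icc (-m) m) (by decide)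
    (convex_Icc _ _) isCompact_Icc
  have hac : AbsolutelyContinuousOnInterval (fun s => Φ (U s)) 0 t := by
    rw [absolutelyContinuousOnInterval_iff] at hUac ⊢
    intro ε hε
    obtain ⟨δ, hδ, H⟩ := hUac (ε / (K + 1)) (by positivity)
    refine ⟨δ, hδ, fun E hE hE2 => ?_⟩
    have h1 := H E hE hE2
    calc _ ≤ ∑ i ∈ Finset.range E.1, K * dist (U (E.2 i).1) (U (E.2 i).2) := by
          apply Finset.sum_le_sum
          intro i hi
          exact hK.dist_le_mul _ (abs_le.1 (hm _ (hE.left i hi).left)) _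
            (abs_le.1 (hm _ (hE.left i hi).right))
      _ = K * ∑ i ∈ Finset.range E.1, dist (U (E.2 i).1) (U (E.2 i).2) := by
          rw [Finset.mul_sum]
      _ ≤ K * (ε / (K + 1)) := by gcongr
      _ < (K + 1) * (ε / (K + 1)) := by gcongr; linarith
      _ = ε := by field
  have h := hac.integral_deriv_eq_sub
  have hU0 : U 0 = u0 := by simp [hU]
  have hUt : U t = u t := (hu t ⟨ht, le_rfl⟩).symm
  rw [hU0, hUt] at h
  rw [← h]
  apply intervalIntegral.integral_congr_ae
  filter_upwards [hg.ae_hasDerivAt_integral] with s hs hs1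
  have hs2 : s ∈ uIcc 0 t := uIoc_subset_uIcc hs1
  have h3 : HasDerivAt U (g s) s := (hs hs2 0 (by simp)).const_add u0
  have h4 := (hΦ (U s)).comp s h3
  have h5 : u s = U s := hu s (by rwa [uIcc_of_le ht] at hs2)
  rw [h5]
  exact h4.deriv.symm

lemma controlled_ode_potential {Φ φ : ℝ → ℝ} (hΦ : ∀ x, HasDerivAt Φ (φ x) x) (hφ : Continuous φ)
    {g u h : ℝ → ℝ} {t u0 : ℝ} (ht : 0 ≤ t) (hg : IntervalIntegrable g volume 0 t)
    (hh : IntervalIntegrable h volume 0 t) (huc : Continuous u)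
    (hu : ∀ s ∈ Icc (0:ℝ) t, u s = u0 + ∫ r in (0:ℝ)..s, g r)
    (hle : ∀ s ∈ Icc (0:ℝ) t, h s ≤ φ (u s) * g s) :
    Φ u0 + ∫ s in (0:ℝ)..t, h s ≤ Φ (u t) := by
  have h1 := controlled_ode_chain hΦ hφ ht hg hu
  have h2 : ∫ s in (0:ℝ)..t, h s ≤ ∫ s in (0:ℝ)..t, φ (u s) * g s :=
    intervalIntegral.integral_mono_on ht hh
      (hg.continuousOn_mul (hφ.comp huc).continuousOn) hle
  linarith

/-- Lipschitz Carathéodory ODE. -/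
lemma controlled_ode_picard {T v₀ : ℝ} (hT : 0 ≤ T) {B S : ℝ → ℝ} {L : NNReal}
    (hB : LipschitzWith L B) (hS : LipschitzWith L S) {f : ℝ → ℝ}
    (hf : ∀ a b, IntervalIntegrable f volume a b) :
    (∃ u : ℝ → ℝ, Continuous u ∧ ∀ t ∈ Icc (0:ℝ) T,
      u t = v₀ + ∫ s in (0:ℝ)..t, (B (u s) + S (u s) * f s)) ∧
    (∀ u w : ℝ → ℝ, Continuous u → Continuous w →
      (∀ t ∈ Icc (0:ℝ) T, u t = v₀ + ∫ s in (0:ℝ)..t, (B (u s) + S (u s) * f s)) →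
      (∀ t ∈ Icc (0:ℝ) T, w t = v₀ + ∫ s in (0:ℝ)..t, (B (w s) + S (w s) * f s)) →
      EqOn u w (Icc 0 T)) := by
  set k : ℝ → ℝ := fun s => 2 * L * (1 + |f s|) with hk
  have hki : ∀ a b, IntervalIntegrable k volume a b := fun a b =>
    (intervalIntegrable_const.add (hf a b).abs).const_mul _
  set K : ℝ → ℝ := fun t => ∫ s in (0:ℝ)..t, k s with hKdef
  have hKc : Continuous K := intervalIntegral.continuous_primitive hki 0
  have hKint : ∀ t, 0 ≤ t → ∫ s in (0:ℝ)..t, Real.exp (K s) * k s = Real.exp (K t) - 1 := by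
    intro t ht
    have := controlled_ode_chain (Φ := Real.exp) (φ := Real.exp) Real.hasDerivAt_exp Real.continuous_exp
      (g := k) (u := K) (u0 := 0) ht (hki 0 t) (fun s _ => by simp [hKdef])
    simpa using this
  have hgi : ∀ u : ℝ → ℝ, Continuous u → ∀ a b,
      IntervalIntegrable (fun s => B (u s) + S (u s) * f s) volume a b := fun u hu a b =>
    ((hB.continuous.comp hu).intervalIntegrable a b).add
      ((hf a b).continuousOn_mul (hS.continuous.comp hu).continuousOn)
  let ext : C(Icc (0:ℝ) T, ℝ) → ℝ → ℝ := fun z s => Real.exp (K s) * IccExtend hT z s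
  have hext : ∀ z, Continuous (ext z) := fun z =>
    (Real.continuous_exp.comp hKc).mul (z.continuous.Icc_extend')
  let op : C(Icc (0:ℝ) T, ℝ) → C(Icc (0:ℝ) T, ℝ) := fun z =>
    ⟨fun t => Real.exp (-K t) * (v₀ + ∫ s in (0:ℝ)..(t:ℝ), (B (ext z s) + S (ext z s) * f s)), by
      have h1 := intervalIntegral.continuous_primitive (hgi _ (hext z)) 0
      have h2 : Continuous (fun t : ℝ => Real.exp (-K t) *
        (v₀ + ∫ s in (0:ℝ)..(t:ℝ), (B (ext z s) + S (ext z s) * f s))) := by fun_prop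
      exact h2.comp continuous_subtype_val⟩
  have hcontr : ContractingWith (1/2 : NNReal) op := by
    refine ⟨by norm_num, LipschitzWith.of_dist_le_mul fun z y => ?_⟩
    rw [ContinuousMap.dist_le (by positivity)]
    rintro ⟨t, ht⟩
    have hd : ∀ s, |IccExtend hT z s - IccExtend hT y s| ≤ dist z y := fun s => by
      rw [← Real.dist_eq]; exact ContinuousMap.dist_apply_le_dist _
    have hb : ‖∫ s in (0:ℝ)..t, ((B (ext z s) + S (ext z s) * f s)
        - (B (ext y s) + S (ext y s) * f s))‖
        ≤ ∫ s in (0:ℝ)..t, (dist z y / 2) * (Real.exp (K s) * k s) := by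
      apply intervalIntegral.norm_integral_le_of_norm_le ht.1
      · refine Filter.Eventually.of_forall fun s _ => ?_
        have e1 : |ext z s - ext y s| ≤ Real.exp (K s) * dist z y := by
          have : ext z s - ext y s = Real.exp (K s) * (IccExtend hT z s - IccExtend hT y s) := by
            simp only [ext]; ring
          rw [this, abs_mul, abs_of_pos (Real.exp_pos _)]
          exact mul_le_mul_of_nonneg_left (hd s) (Real.exp_pos _).le
        have e2 : |B (ext z s) - B (ext y s)| ≤ L * |ext z s - ext y s| := by
          simpa [Real.dist_eq] using hB.dist_le_mul (ext z s) (ext y s)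
        have e3 : |S (ext z s) - S (ext y s)| ≤ L * |ext z s - ext y s| := by
          simpa [Real.dist_eq] using hS.dist_le_mul (ext z s) (ext y s)
        have e4 : (B (ext z s) + S (ext z s) * f s) - (B (ext y s) + S (ext y s) * f s)
          = (B (ext z s) - B (ext y s)) + (S (ext z s) - S (ext y s)) * f s := by ring
        rw [e4, Real.norm_eq_abs]
        calc _ ≤ |B (ext z s) - B (ext y s)| + |S (ext z s) - S (ext y s)| * |f s| := by
              rw [← abs_mul]; exact abs_add_le _ _
          _ ≤ L * (Real.exp (K s) * dist z y) + L * (Real.exp (K s) * dist z y) * |f s| := by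
              have e5 := mul_le_mul_of_nonneg_left e1 L.2
              gcongr
              · exact e2.trans e5
              · exact e3.trans e5
          _ = _ := by simp only [hk]; ring
      · exact ((hki 0 t).continuousOn_mul
          (Real.continuous_exp.comp hKc).continuousOn).const_mul _
    rw [intervalIntegral.integral_const_mul, hKint t ht.1,
      intervalIntegral.integral_sub (hgi _ (hext z) _ _) (hgi _ (hext y) _ _)] at hb
    have e6 : op z ⟨t, ht⟩ - op y ⟨t, ht⟩ = Real.exp (-K t) *
      ((∫ s in (0:ℝ)..t, (B (ext z s) + S (ext z s) * f s)) -
       (∫ s in (0:ℝ)..t, (B (ext y s) + S (ext y s) * f s))) := by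
      simp only [op, ContinuousMap.coe_mk]; ring
    rw [Real.dist_eq, e6, abs_mul, abs_of_pos (Real.exp_pos _)]
    calc _ ≤ Real.exp (-K t) * (dist z y / 2 * (Real.exp (K t) - 1)) :=
          mul_le_mul_of_nonneg_left hb (Real.exp_pos _).le
      _ = dist z y / 2 * (Real.exp (-K t) * Real.exp (K t)) - dist z y / 2 * Real.exp (-K t) := by
          ring
      _ ≤ dist z y / 2 := by
          rw [← Real.exp_add]
          have : 0 ≤ dist z y / 2 * Real.exp (-K t) := by positivity
          simp; linarith
      _ = _ := by push_cast; ring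
  constructor
  · have : Nonempty C(Icc (0:ℝ) T, ℝ) := ⟨0⟩
    set z := hcontr.fixedPoint op with hz
    have hfix : op z = z := hcontr.fixedPoint_isFixedPt
    refine ⟨ext z, hext z, fun t ht => ?_⟩
    have h1 : op z ⟨t, ht⟩ = z ⟨t, ht⟩ := by rw [hfix]
    have h2 : ext z t = Real.exp (K t) * op z ⟨t, ht⟩ := by
      rw [h1]; simp only [ext, IccExtend_of_mem hT _ ht]
    rw [h2]
    simp only [op, ContinuousMap.coe_mk]
    rw [← mul_assoc, ← Real.exp_add]; simp
  · have key : ∀ u : ℝ → ℝ, ∀ hu : Continuous u,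
        (∀ t ∈ Icc (0:ℝ) T, u t = v₀ + ∫ s in (0:ℝ)..t, (B (u s) + S (u s) * f s)) →
        ∃ z : C(Icc (0:ℝ) T, ℝ), op z = z ∧ ∀ t (ht : t ∈ Icc (0:ℝ) T),
          u t = Real.exp (K t) * z ⟨t, ht⟩ := by
      intro u hu h
      let z : C(Icc (0:ℝ) T, ℝ) := ⟨fun t => Real.exp (-K t) * u t, by fun_prop⟩
      have hzu : ∀ t (ht : t ∈ Icc (0:ℝ) T), u t = Real.exp (K t) * z ⟨t, ht⟩ := by
        intro t ht
        simp only [z, ContinuousMap.coe_mk]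
        rw [← mul_assoc, ← Real.exp_add]; simp
      refine ⟨z, ?_, hzu⟩
      have he : ∀ t ∈ Icc (0:ℝ) T, ext z t = u t := fun t ht => by
        simp only [ext, IccExtend_of_mem hT _ ht, hzu t ht]
      ext ⟨t, ht⟩
      have : ∫ s in (0:ℝ)..t, (B (ext z s) + S (ext z s) * f s) =
          ∫ s in (0:ℝ)..t, (B (u s) + S (u s) * f s) := by
        apply intervalIntegral.integral_congr
        intro s hs
        rw [uIcc_of_le ht.1] at hs
        simp only [he s ⟨hs.1, hs.2.trans ht.2⟩]
      simp only [op, ContinuousMap.coe_mk, this, ← h t ht]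
      rfl
    intro u w hu hw h1 h2
    obtain ⟨z, hz, hz'⟩ := key u hu h1
    obtain ⟨y, hy, hy'⟩ := key w hw h2
    have : z = y := hcontr.fixedPoint_unique' hz hy
    intro t ht
    rw [hz' t ht, hy' t ht, this]

lemma controlled_ode_barrier {γ : ℝ → ℝ} (hγcont : ContinuousOn γ (Ioi (0:ℝ)))
    (hγpos : ∀ u : ℝ, 0 < u → 0 < γ u)
    (hγint : ∀ ε : ℝ, 0 < ε → ¬ IntegrableOn (fun u => 1 / (γ u)^2) (Ioc (0:ℝ) ε))
    {η ε : ℝ} (hη : 0 < η) (hηε : η < ε) (C : ℝ) :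
    ∃ δ' δ : ℝ, 0 < δ' ∧ δ' < δ ∧ δ < η ∧ ∃ φ : ℝ → ℝ, Continuous φ ∧ (∀ x, 0 ≤ φ x) ∧
      (∀ x, x ≤ δ' → φ x = 0) ∧ (∀ x, ε ≤ x → φ x = 0) ∧
      (∀ x, δ' < x → φ x * γ x ^ 2 ≤ 1) ∧ C < ∫ x in δ..η, φ x := by
  have hc : ContinuousOn (fun u => 1 / (γ u)^2) (Ioi (0:ℝ)) :=
    continuousOn_const.div (hγcont.pow 2) fun x hx => (pow_pos (hγpos x hx) 2).ne'
  obtain ⟨δ, hδ, hδη, hδC⟩ : ∃ δ, 0 < δ ∧ δ < η ∧ C < ∫ x in δ..η, 1 / (γ x)^2 := by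
    by_contra! hcon
    apply hγint η hη
    have hlim : Filter.Tendsto (fun n : ℕ => η / ((n:ℝ) + 2)) Filter.atTop (nhds 0) := by
      apply Filter.Tendsto.div_atTop tendsto_const_nhds
      exact Filter.tendsto_atTop_add_const_right _ _ tendsto_natCast_atTop_atTop
    have hn : ∀ n : ℕ, 0 < η / ((n:ℝ) + 2) ∧ η / ((n:ℝ) + 2) < η := fun n => by
      refine ⟨by positivity, ?_⟩
      apply div_lt_self hη
      have : (0:ℝ) ≤ n := n.cast_nonneg
      linarith
    refine integrableOn_Ioc_of_intervalIntegral_norm_bounded_left (I := C)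
      (fun n : ℕ => ?_) hlim (Filter.Eventually.of_forall fun n => ?_)
    · exact ((hc.mono fun x hx => lt_of_lt_of_le (hn n).1 hx.1).integrableOn_Icc).mono_set
        Ioc_subset_Icc_self
    · have := hcon _ (hn n).1 (hn n).2
      rw [intervalIntegral.integral_of_le (hn n).2.le] at this
      refine le_trans (le_of_eq ?_) this
      congr 1 with x
      rw [Real.norm_of_nonneg (by positivity)]
  refine ⟨δ / 2, δ, by positivity, by linarith, hδη, ?_⟩
  set χ : ℝ → ℝ := fun x => max 0 (min 1 (min ((x - δ/2) / (δ/2)) ((ε - x) / (ε - η)))) with hχ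
  have hεη : 0 < ε - η := by linarith
  have hχ0 : ∀ x, 0 ≤ χ x := fun x => le_max_left _ _
  have hχ1 : ∀ x, χ x ≤ 1 := fun x => max_le zero_le_one (min_le_left _ _)
  have hχc : Continuous χ := by simp only [hχ]; fun_prop
  have hmax : ∀ x, 0 < max x (δ/2) := fun x => lt_max_of_lt_right (by positivity)
  refine ⟨fun x => χ x * (1 / (γ (max x (δ/2)))^2), ?_, ?_, ?_, ?_, ?_, ?_⟩
  · exact hχc.mul (hc.comp_continuous (by fun_prop) hmax)
  · intro x; have := hχ0 x; positivity
  · intro x hx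
    have : χ x = 0 := by
      apply max_eq_left
      refine (min_le_right _ _).trans ((min_le_left _ _).trans ?_)
      exact div_nonpos_of_nonpos_of_nonneg (by linarith) (by linarith)
    simp [this]
  · intro x hx
    have : χ x = 0 := by
      apply max_eq_left
      refine (min_le_right _ _).trans ((min_le_right _ _).trans ?_)
      exact div_nonpos_of_nonpos_of_nonneg (by linarith) (by linarith)
    simp [this]
  · intro x hx
    simp only [max_eq_left hx.le]
    have := hγpos x (by linarith)
    rw [mul_assoc, one_div, inv_mul_cancel₀ (by positivity), mul_one]
    exact hχ1 x
  · refine lt_of_lt_of_eq hδC ?_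
    apply intervalIntegral.integral_congr
    intro x hx
    rw [uIcc_of_le hδη.le] at hx
    have h1 : max x (δ/2) = x := max_eq_left (by linarith [hx.1])
    have h2 : χ x = 1 := by
      have a1 : 1 ≤ (x - δ/2) / (δ/2) := by rw [one_le_div (by positivity)]; linarith [hx.1]
      have a2 : 1 ≤ (ε - x) / (ε - η) := by rw [one_le_div hεη]; linarith [hx.2]
      simp only [hχ]
      rw [min_eq_left (le_min a1 a2)]
      exact max_eq_right zero_le_one
    simp only [h1, h2, one_mul]

lemma controlled_ode_lower {γ φ : ℝ → ℝ} {δ' δ η ε c T v₀ : ℝ} (hc : 0 < c)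
    (hδη : δ < η) (hηv : η ≤ v₀) (hδδ : δ' < δ)
    {f : ℝ → ℝ} (hf2 : ∀ a b, IntervalIntegrable (fun s => f s ^ 2) volume a b)
    (hφc : Continuous φ) (hφ0 : ∀ x, 0 ≤ φ x) (hφ1 : ∀ x, x ≤ δ' → φ x = 0)
    (hφ2 : ∀ x, ε ≤ x → φ x = 0) (hφ3 : ∀ x, δ' < x → φ x * γ x ^ 2 ≤ 1)
    (hφ4 : 1 / (4 * c) * ∫ s in (0:ℝ)..T, f s ^ 2 < ∫ x in δ..η, φ x)
    {B S u : ℝ → ℝ} (hu : Continuous u)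
    (hg : IntervalIntegrable (fun s => B (u s) + S (u s) * f s) volume 0 T)
    (hB : ∀ x, δ' < x → x < ε → c ≤ B x) (hS : ∀ x, δ' < x → x < ε → |S x| ≤ γ x)
    (hsol : ∀ t ∈ Icc (0:ℝ) T, u t = v₀ + ∫ s in (0:ℝ)..t, (B (u s) + S (u s) * f s)) :
    ∀ t ∈ Icc (0:ℝ) T, δ' < u t := by
  intro t ht
  have hφi : ∀ a b, IntervalIntegrable φ volume a b := fun a b => hφc.intervalIntegrable a b
  have hΦ : ∀ x, HasDerivAt (fun y => ∫ r in δ..y, φ r) (φ x) x := fun x =>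
    intervalIntegral.integral_hasDerivAt_right (hφi _ _)
      hφc.stronglyMeasurable.stronglyMeasurableAtFilter hφc.continuousAt
  have hsub : uIcc 0 t ⊆ uIcc 0 T := by
    rw [uIcc_of_le ht.1, uIcc_of_le (ht.1.trans ht.2)]; exact Icc_subset_Icc_right ht.2
  have hp := controlled_ode_potential hΦ hφc (h := fun s => -(1 / (4 * c)) * f s ^ 2) ht.1
    (hg.mono_set hsub) ((hf2 0 t).const_mul _) hu
    (fun s hs => hsol s ⟨hs.1, hs.2.trans ht.2⟩) (by
      intro s hs
      have hq : 0 ≤ 1 / (4 * c) * f s ^ 2 := by positivity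
      rcases le_or_gt (u s) δ' with h1 | h1
      · rw [hφ1 _ h1]; linarith
      rcases le_or_gt ε (u s) with h2 | h2
      · rw [hφ2 _ h2]; linarith
      have b1 := hB _ h1 h2
      have b2 := hS _ h1 h2
      have b3 := hφ3 _ h1
      have b0 := hφ0 (u s)
      have b4 : -(γ (u s) * |f s|) ≤ S (u s) * f s := by
        have : |S (u s) * f s| ≤ γ (u s) * |f s| := by rw [abs_mul]; gcongr
        linarith [neg_abs_le (S (u s) * f s)]
      have b5 : -(1 / (4 * c)) * (γ (u s) ^ 2 * f s ^ 2) ≤ c - γ (u s) * |f s| := by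
        rw [← sq_abs (f s)]
        have : c - γ (u s) * |f s| + 1 / (4 * c) * (γ (u s) ^ 2 * |f s| ^ 2)
          = 1 / (4 * c) * (2 * c - γ (u s) * |f s|) ^ 2 := by field_simp; ring
        have h3 : 0 ≤ 1 / (4 * c) * (2 * c - γ (u s) * |f s|) ^ 2 := by positivity
        linarith
      have b6 : φ (u s) * (-(1 / (4 * c)) * (γ (u s) ^ 2 * f s ^ 2)) ≤
          φ (u s) * (B (u s) + S (u s) * f s) :=
        mul_le_mul_of_nonneg_left (by linarith) b0
      have b7 := mul_le_mul_of_nonneg_right b3 hq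
      linarith)
  rw [intervalIntegral.integral_const_mul] at hp
  have hmono : ∫ s in (0:ℝ)..t, f s ^ 2 ≤ ∫ s in (0:ℝ)..T, f s ^ 2 :=
    intervalIntegral.integral_mono_interval le_rfl ht.1 ht.2
      (Filter.Eventually.of_forall fun s => sq_nonneg _) (hf2 0 T)
  have hmono' := mul_le_mul_of_nonneg_left hmono (by positivity : 0 ≤ 1 / (4 * c))
  have hv : ∫ x in δ..η, φ x ≤ ∫ x in δ..v₀, φ x :=
    intervalIntegral.integral_mono_interval le_rfl hδη.le hηv
      (Filter.Eventually.of_forall fun s => hφ0 _) (hφi _ _)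
  by_contra! hcon
  have hneg : ∫ r in δ..u t, φ r ≤ 0 := by
    rw [intervalIntegral.integral_symm]
    have : 0 ≤ ∫ r in (u t)..δ, φ r :=
      intervalIntegral.integral_nonneg (by linarith) fun x _ => hφ0 x
    linarith
  linarith

lemma controlled_ode_upper {μ T v₀ : ℝ} (hμ : 0 < μ) {f : ℝ → ℝ}
    (hf : ∀ a b, IntervalIntegrable f volume a b)
    {B S u : ℝ → ℝ} (hu : Continuous u)
    (hg : IntervalIntegrable (fun s => B (u s) + S (u s) * f s) volume 0 T)
    (hB : ∀ t ∈ Icc (0:ℝ) T, |B (u t)| ≤ μ * √(1 + u t ^ 2))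
    (hS : ∀ t ∈ Icc (0:ℝ) T, |S (u t)| ≤ μ * √(1 + u t ^ 2))
    (hsol : ∀ t ∈ Icc (0:ℝ) T, u t = v₀ + ∫ s in (0:ℝ)..t, (B (u s) + S (u s) * f s)) :
    ∀ t ∈ Icc (0:ℝ) T, u t ≤
      Real.exp (Real.log (1 + v₀ ^ 2) + ∫ s in (0:ℝ)..T, 2 * μ * (1 + |f s|)) := by
  intro t ht
  have hki : ∀ a b, IntervalIntegrable (fun s => 2 * μ * (1 + |f s|)) volume a b := fun a b =>
    (intervalIntegrable_const.add (hf a b).abs).const_mul _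
  have hpos : ∀ x : ℝ, 0 < 1 + x ^ 2 := fun x => by positivity
  have hΦ : ∀ x : ℝ, HasDerivAt (fun y => -Real.log (1 + y ^ 2)) (-(2 * x / (1 + x ^ 2))) x := by
    intro x
    have h1 : HasDerivAt (fun y : ℝ => 1 + y ^ 2) (2 * x) x := by
      simpa using (hasDerivAt_pow 2 x).const_add 1
    exact (h1.log (hpos x).ne').neg
  have hφc : Continuous (fun x : ℝ => -(2 * x / (1 + x ^ 2))) :=
    (Continuous.div (by fun_prop) (by fun_prop) fun x => (hpos x).ne').neg
  have hsub : uIcc 0 t ⊆ uIcc 0 T := by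
    rw [uIcc_of_le ht.1, uIcc_of_le (ht.1.trans ht.2)]; exact Icc_subset_Icc_right ht.2
  have hp := controlled_ode_potential hΦ hφc (h := fun s => -(2 * μ * (1 + |f s|))) ht.1
    (hg.mono_set hsub) (hki 0 t).neg hu
    (fun s hs => hsol s ⟨hs.1, hs.2.trans ht.2⟩) (by
      intro s hs
      have hs' : s ∈ Icc (0:ℝ) T := ⟨hs.1, hs.2.trans ht.2⟩
      set r := √(1 + u s ^ 2) with hr
      have hr0 : 0 < r := Real.sqrt_pos.2 (hpos _)
      have hr2 : 1 + u s ^ 2 = r ^ 2 := (Real.sq_sqrt (hpos _).le).symm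
      have hur : |u s| ≤ r := Real.abs_le_sqrt (by linarith)
      have hgb : |B (u s) + S (u s) * f s| ≤ μ * r * (1 + |f s|) := by
        calc _ ≤ |B (u s)| + |S (u s)| * |f s| := by rw [← abs_mul]; exact abs_add_le _ _
          _ ≤ μ * r + μ * r * |f s| := by
            have := hB s hs'; have := hS s hs'; gcongr
          _ = _ := by ring
      have hφb : |-(2 * u s / (1 + u s ^ 2))| ≤ 2 / r := by
        rw [abs_neg, abs_div, abs_mul, hr2, abs_of_pos (pow_pos hr0 2), abs_two]
        rw [div_le_div_iff₀ (by positivity) hr0]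
        nlinarith
      have := neg_abs_le (-(2 * u s / (1 + u s ^ 2)) * (B (u s) + S (u s) * f s))
      rw [abs_mul] at this
      have h5 : |-(2 * u s / (1 + u s ^ 2))| * |B (u s) + S (u s) * f s|
          ≤ 2 / r * (μ * r * (1 + |f s|)) := by gcongr
      have h6 : 2 / r * (μ * r * (1 + |f s|)) = 2 * μ * (1 + |f s|) := by field_simp
      linarith)
  rw [intervalIntegral.integral_neg] at hp
  have hmono : ∫ s in (0:ℝ)..t, 2 * μ * (1 + |f s|) ≤ ∫ s in (0:ℝ)..T, 2 * μ * (1 + |f s|) :=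
    intervalIntegral.integral_mono_interval le_rfl ht.1 ht.2
      (Filter.Eventually.of_forall fun s => by
        simp only [Pi.zero_apply]; positivity) (hki 0 T)
  have h7 : Real.log (1 + u t ^ 2) ≤
      Real.log (1 + v₀ ^ 2) + ∫ s in (0:ℝ)..T, 2 * μ * (1 + |f s|) := by linarith
  have h8 := (Real.log_le_iff_le_exp (hpos _)).1 h7
  nlinarith [sq_nonneg (u t - 1)]

lemma controlled_ode_core
    (T : ℝ) (hT : 0 < T) (v₀ : ℝ) (hv₀ : 0 < v₀)
    (μ : ℝ) (hμ : 0 < μ)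
    (bb sb : ℝ → ℝ)
    (hbgrow : ∀ x : ℝ, (bb x)^2 ≤ μ^2 * (1 + x^2))
    (hsgrow : ∀ x : ℝ, (sb x)^2 ≤ μ^2 * (1 + x^2))
    (hblip : LocallyLipschitz bb) (hb0 : 0 < bb 0)
    (hslip : ∀ x : ℝ, x ≠ 0 → ∃ u ∈ nhds x, ∃ L : NNReal, LipschitzOnWith L sb u)
    (hs0 : sb 0 = 0)
    (γ : ℝ → ℝ) (hγcont : ContinuousOn γ (Ioi (0:ℝ)))
    (hγpos : ∀ u : ℝ, 0 < u → 0 < γ u)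
    (hγint : ∀ ε : ℝ, 0 < ε → ¬ IntegrableOn (fun u => 1 / (γ u)^2) (Ioc (0:ℝ) ε))
    (hγbound : ∀ x y : ℝ, x ≠ y → |sb x - sb y| ≤ γ |x - y|)
    (f : ℝ → ℝ) (hf : ∀ a b, IntervalIntegrable f volume a b)
    (hf2 : ∀ a b, IntervalIntegrable (fun s => f s ^ 2) volume a b)
    (hint : ∀ u : ℝ → ℝ, Continuous u →
      IntervalIntegrable (fun s => bb (u s) + sb (u s) * f s) volume 0 T) :
    (∃ u : ℝ → ℝ, Continuous u ∧ ∀ t ∈ Icc (0:ℝ) T,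
      u t = v₀ + ∫ s in (0:ℝ)..t, (bb (u s) + sb (u s) * f s)) ∧
    (∀ u w : ℝ → ℝ, Continuous u → Continuous w →
      (∀ t ∈ Icc (0:ℝ) T, u t = v₀ + ∫ s in (0:ℝ)..t, (bb (u s) + sb (u s) * f s)) →
      (∀ t ∈ Icc (0:ℝ) T, w t = v₀ + ∫ s in (0:ℝ)..t, (bb (w s) + sb (w s) * f s)) →
      EqOn u w (Icc 0 T)) := by
  have hc : 0 < bb 0 / 2 := by linarith
  obtain ⟨ε, hε, hεb⟩ : ∃ ε > 0, ∀ x, 0 < x → x < ε → bb 0 / 2 ≤ bb x := by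
    have h1 : ∀ᶠ x in nhds (0:ℝ), bb 0 / 2 < bb x :=
      hblip.continuous.continuousAt.eventually (lt_mem_nhds (by linarith))
    obtain ⟨ε, hε, h⟩ := Metric.eventually_nhds_iff.1 h1
    refine ⟨ε, hε, fun x h0 hx => (h ?_).le⟩
    rwa [Real.dist_eq, sub_zero, abs_of_pos h0]
  have hη : 0 < min v₀ (ε / 2) := lt_min hv₀ (by linarith)
  have hηε : min v₀ (ε / 2) < ε := (min_le_right _ _).trans_lt (by linarith)
  obtain ⟨δ', δ, hδ'0, hδδ, hδη, φ, hφc, hφ0, hφ1, hφ2, hφ3, hφ4⟩ :=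
    controlled_ode_barrier hγcont hγpos hγint hη hηε
      (1 / (4 * (bb 0 / 2)) * ∫ s in (0:ℝ)..T, f s ^ 2)
  set R := Real.exp (Real.log (1 + v₀ ^ 2) + ∫ s in (0:ℝ)..T, 2 * μ * (1 + |f s|)) with hR
  have hR0 : 0 < R := Real.exp_pos _
  set M := R + ε with hM
  have hδM : δ' ≤ M := by linarith
  have hgrow : ∀ {a x : ℝ}, a ^ 2 ≤ μ ^ 2 * (1 + x ^ 2) → |a| ≤ μ * √(1 + x ^ 2) := by
    intro a x h
    have := Real.abs_le_sqrt h
    rwa [Real.sqrt_mul (by positivity), Real.sqrt_sq hμ.le] at this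
  have hsγ : ∀ x, 0 < x → |sb x| ≤ γ x := fun x hx => by
    have := hγbound x 0 hx.ne'
    rwa [hs0, sub_zero, sub_zero, abs_of_pos hx] at this
  have hBlip : ∃ K, LipschitzOnWith K bb (Icc δ' M) :=
    LocallyLipschitzOn.exists_lipschitzOnWith_of_compact isCompact_Icc
      (hblip.locallyLipschitzOn)
  have hSlip : ∃ K, LipschitzOnWith K sb (Icc δ' M) := by
    refine LocallyLipschitzOn.exists_lipschitzOnWith_of_compact isCompact_Icc ?_
    intro x hx
    obtain ⟨u, hu, K, hK⟩ := hslip x (by linarith [hx.1] : 0 < x).ne'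
    exact ⟨K, u, mem_nhdsWithin_of_mem_nhds hu, hK⟩
  obtain ⟨K1, hK1⟩ := hBlip
  obtain ⟨K2, hK2⟩ := hSlip
  let p : ℝ → ℝ := fun x => (projIcc δ' M hδM x : ℝ)
  have hpmem : ∀ x, p x ∈ Icc δ' M := fun x => (projIcc δ' M hδM x).2
  have hpid : ∀ x ∈ Icc δ' M, p x = x := fun x hx => by
    simp only [p, projIcc_of_mem hδM hx]
  have hplip : LipschitzWith 1 p := by
    have := LipschitzWith.projIcc hδM
    exact this
  have hB : LipschitzWith (max K1 K2) (fun x => bb (p x)) := by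
    have := (hK1.weaken (le_max_left K1 K2)).comp (hplip.lipschitzOnWith (s := univ))
      (fun x _ => hpmem x)
    simpa [Function.comp_def] using this
  have hS : LipschitzWith (max K1 K2) (fun x => sb (p x)) := by
    have := (hK2.weaken (le_max_right K1 K2)).comp (hplip.lipschitzOnWith (s := univ))
      (fun x _ => hpmem x)
    simpa [Function.comp_def] using this
  have hple : ∀ x, δ' < x → p x ≤ x := fun x hx => by
    simp only [p, coe_projIcc]; exact max_le hx.le (min_le_right _ _)
  obtain ⟨⟨u, huc, hu⟩, huniq⟩ := controlled_ode_picard (v₀ := v₀) hT.le hB hS hf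
  -- bounds for the truncated equation
  have hu_mem : ∀ t ∈ Icc (0:ℝ) T, u t ∈ Icc δ' M := by
    have hgi : IntervalIntegrable (fun s => bb (p (u s)) + sb (p (u s)) * f s) volume 0 T :=
      ((hB.continuous.comp huc).intervalIntegrable _ _).add
        ((hf _ _).continuousOn_mul (hS.continuous.comp huc).continuousOn)
    have hlo := controlled_ode_lower hc hδη (min_le_left _ _) hδδ hf2 hφc hφ0 hφ1 hφ2 hφ3 hφ4 huc hgi
      (B := fun x => bb (p x)) (S := fun x => sb (p x))
      (fun x h1 h2 => by
        simp only [hpid x ⟨h1.le, by linarith⟩]; exact hεb x (by linarith) h2)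
      (fun x h1 h2 => by
        simp only [hpid x ⟨h1.le, by linarith⟩]; exact hsγ x (by linarith)) hu
    have hsq : ∀ t ∈ Icc (0:ℝ) T, p (u t) ^ 2 ≤ u t ^ 2 := fun t ht => by
      have h1 := hple _ (hlo t ht)
      have h2 := (hpmem (u t)).1
      exact pow_le_pow_left₀ (by linarith) h1 2
    have hup := controlled_ode_upper hμ hf huc hgi (B := fun x => bb (p x)) (S := fun x => sb (p x))
      (fun t ht => hgrow ((hbgrow _).trans (by have := hsq t ht; gcongr)))
      (fun t ht => hgrow ((hsgrow _).trans (by have := hsq t ht; gcongr))) hu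
    exact fun t ht => ⟨(hlo t ht).le, (hup t ht).trans (by linarith)⟩
  have ho_mem : ∀ w : ℝ → ℝ, Continuous w →
      (∀ t ∈ Icc (0:ℝ) T, w t = v₀ + ∫ s in (0:ℝ)..t, (bb (w s) + sb (w s) * f s)) →
      ∀ t ∈ Icc (0:ℝ) T, w t ∈ Icc δ' M := by
    intro w hw hsol
    have hlo := controlled_ode_lower hc hδη (min_le_left _ _) hδδ hf2 hφc hφ0 hφ1 hφ2 hφ3 hφ4 hw
      (hint w hw) (fun x h1 h2 => hεb x (by linarith) h2) (fun x h1 h2 => hsγ x (by linarith)) hsol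
    have hup := controlled_ode_upper hμ hf hw (hint w hw) (fun t ht => hgrow (hbgrow _))
      (fun t ht => hgrow (hsgrow _)) hsol
    exact fun t ht => ⟨(hlo t ht).le, (hup t ht).trans (by linarith)⟩
  have hswap : ∀ w : ℝ → ℝ, (∀ t ∈ Icc (0:ℝ) T, w t ∈ Icc δ' M) → ∀ t ∈ Icc (0:ℝ) T,
      ∫ s in (0:ℝ)..t, (bb (p (w s)) + sb (p (w s)) * f s) =
      ∫ s in (0:ℝ)..t, (bb (w s) + sb (w s) * f s) := by
    intro w hw t ht
    apply intervalIntegral.integral_congr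
    intro s hs
    rw [uIcc_of_le ht.1] at hs
    simp only [hpid _ (hw s ⟨hs.1, hs.2.trans ht.2⟩)]
  refine ⟨⟨u, huc, fun t ht => ?_⟩, fun v w hv hw h1 h2 => ?_⟩
  · rw [← hswap u hu_mem t ht]; exact hu t ht
  · refine huniq v w hv hw (fun t ht => ?_) (fun t ht => ?_)
    · rw [hswap v (ho_mem v hv h1) t ht]; exact h1 t ht
    · rw [hswap w (ho_mem w hw h2) t ht]; exact h2 t ht
/-- under Assumption (R) (Yamada–Watanabe condition), for every control
`f ∈ L²[0,T]` there is exactly one continuous solution of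
`v(t) = v₀ + ∫₀^t b̄(v(s)) ds + ∫₀^t σ̄(v(s)) f(s) ds` on `[0,T]`. -/
theorem controlled_ode_exists_unique
    (T : ℝ) (hT : 0 < T) (v₀ : ℝ) (hv₀ : 0 < v₀)
    (μ : ℝ) (hμ : 0 < μ)
    (bb sb : ℝ → ℝ)
    (hbgrow : ∀ x : ℝ, (bb x)^2 ≤ μ^2 * (1 + x^2))
    (hsgrow : ∀ x : ℝ, (sb x)^2 ≤ μ^2 * (1 + x^2))
    (hblip : LocallyLipschitz bb) (hb0 : 0 < bb 0)
    (hsnonneg : ∀ x : ℝ, 0 ≤ sb x)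
    (hslip : ∀ x : ℝ, x ≠ 0 → ∃ u ∈ nhds x, ∃ L : NNReal, LipschitzOnWith L sb u)
    (hs0 : sb 0 = 0) (hspos : ∀ x : ℝ, x ≠ 0 → 0 < sb x)
    (γ : ℝ → ℝ) (hγcont : ContinuousOn γ (Ioi (0:ℝ)))
    (hγmono : MonotoneOn γ (Ioi (0:ℝ)))
    (hγpos : ∀ u : ℝ, 0 < u → 0 < γ u)
    (hγint : ∀ ε : ℝ, 0 < ε → ¬ IntegrableOn (fun u => 1 / (γ u)^2) (Ioc (0:ℝ) ε))
    (hγbound : ∀ x y : ℝ, x ≠ y → |sb x - sb y| ≤ γ |x - y|) :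
    ∀ f : ℝ → ℝ, Measurable f → IntegrableOn (fun s => (f s)^2) (Icc (0:ℝ) T) →
      (∃ v : ℝ → ℝ, ContinuousOn v (Icc (0:ℝ) T) ∧
        ∀ t ∈ Icc (0:ℝ) T,
          v t = v₀ + (∫ s in Icc (0:ℝ) t, bb (v s)) + ∫ s in Icc (0:ℝ) t, sb (v s) * f s) ∧
      (∀ v w : ℝ → ℝ,
        ContinuousOn v (Icc (0:ℝ) T) →
        (∀ t ∈ Icc (0:ℝ) T,
          v t = v₀ + (∫ s in Icc (0:ℝ) t, bb (v s)) + ∫ s in Icc (0:ℝ) t, sb (v s) * f s) →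
        ContinuousOn w (Icc (0:ℝ) T) →
        (∀ t ∈ Icc (0:ℝ) T,
          w t = v₀ + (∫ s in Icc (0:ℝ) t, bb (w s)) + ∫ s in Icc (0:ℝ) t, sb (w s) * f s) →
        EqOn v w (Icc (0:ℝ) T)) := by
  intro f hfm hf2
  have hfi : IntegrableOn f (Icc 0 T) := by
    have h2 : MemLp f 2 (volume.restrict (Icc 0 T)) :=
      (memLp_two_iff_integrable_sq hfm.aestronglyMeasurable).2 hf2
    exact h2.integrable one_le_two
  set F : ℝ → ℝ := (Icc (0:ℝ) T).indicator f with hF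
  have hFf : ∀ s ∈ Icc (0:ℝ) T, F s = f s := fun s hs => indicator_of_mem hs f
  have hFi : Integrable F := (integrable_indicator_iff measurableSet_Icc).2 hfi
  have hFm : Measurable F := hfm.indicator measurableSet_Icc
  have hF2i : Integrable (fun s => F s ^ 2) := by
    have h1 : (fun s => F s ^ 2) = (Icc (0:ℝ) T).indicator (fun s => f s ^ 2) := by
      ext s
      by_cases hs : s ∈ Icc (0:ℝ) T
      · simp [hF, hs]
      · simp [hF, hs]
    rw [h1]
    exact (integrable_indicator_iff measurableSet_Icc).2 hf2
  have hsm : Measurable sb := by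
    refine measurable_of_continuousOn_compl_singleton 0 fun x hx => ?_
    obtain ⟨u, hu, L, hL⟩ := hslip x hx
    exact (hL.continuousOn.continuousAt hu).continuousWithinAt
  have hbi : ∀ u : ℝ → ℝ, Continuous u → ∀ a b,
      IntervalIntegrable (fun s => bb (u s)) volume a b := fun u hu a b =>
    (hblip.continuous.comp hu).intervalIntegrable a b
  have hsi : ∀ u : ℝ → ℝ, Continuous u → ∀ a b,
      IntervalIntegrable (fun s => sb (u s) * F s) volume a b := by
    intro u hu a b
    have h1 : IntervalIntegrable (fun s => (μ * √(1 + u s ^ 2)) * F s) volume a b :=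
      (hFi.intervalIntegrable (a := a) (b := b)).continuousOn_mul
        (by fun_prop : Continuous fun s => μ * √(1 + u s ^ 2)).continuousOn
    refine h1.mono_fun ((hsm.comp hu.measurable).mul hFm).aestronglyMeasurable
      (Filter.Eventually.of_forall fun s => ?_)
    simp only [norm_mul, Real.norm_eq_abs]
    have h2 := Real.abs_le_sqrt (hsgrow (u s))
    rw [Real.sqrt_mul (by positivity), Real.sqrt_sq hμ.le] at h2
    have h3 : |sb (u s)| ≤ |μ| * |√(1 + u s ^ 2)| := by
      rw [← abs_mul]; exact h2.trans (le_abs_self _)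
    gcongr
  obtain ⟨⟨u, huc, hu⟩, huniq⟩ := controlled_ode_core T hT v₀ hv₀ μ hμ bb sb hbgrow hsgrow hblip hb0
    hslip hs0 γ hγcont hγpos hγint hγbound F (fun a b => hFi.intervalIntegrable)
    (fun a b => hF2i.intervalIntegrable) (fun u hu => (hbi u hu _ _).add (hsi u hu _ _))
  have hconv : ∀ v u : ℝ → ℝ, Continuous u → (∀ s ∈ Icc (0:ℝ) T, v s = u s) →
      ∀ t ∈ Icc (0:ℝ) T,
      v₀ + (∫ s in Icc (0:ℝ) t, bb (v s)) + ∫ s in Icc (0:ℝ) t, sb (v s) * f s =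
      v₀ + ∫ s in (0:ℝ)..t, (bb (u s) + sb (u s) * F s) := by
    intro v u hu hvu t ht
    rw [intervalIntegral.integral_add (hbi u hu _ _) (hsi u hu _ _), ← add_assoc,
      intervalIntegral.integral_of_le ht.1, intervalIntegral.integral_of_le ht.1,
      ← integral_Icc_eq_integral_Ioc, ← integral_Icc_eq_integral_Ioc]
    congr 1
    · congr 1
      refine setIntegral_congr_fun measurableSet_Icc fun s hs => ?_
      simp only [hvu s ⟨hs.1, hs.2.trans ht.2⟩]
    · refine setIntegral_congr_fun measurableSet_Icc fun s hs => ?_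
      simp only [hvu s ⟨hs.1, hs.2.trans ht.2⟩, hFf s ⟨hs.1, hs.2.trans ht.2⟩]
  refine ⟨⟨u, huc.continuousOn, fun t ht => ?_⟩, ?_⟩
  · rw [hconv u u huc (fun _ _ => rfl) t ht]; exact hu t ht
  · have key : ∀ v : ℝ → ℝ, ContinuousOn v (Icc (0:ℝ) T) →
        (∀ t ∈ Icc (0:ℝ) T,
          v t = v₀ + (∫ s in Icc (0:ℝ) t, bb (v s)) + ∫ s in Icc (0:ℝ) t, sb (v s) * f s) →
        ∃ V : ℝ → ℝ, Continuous V ∧ (∀ s ∈ Icc (0:ℝ) T, v s = V s) ∧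
          ∀ t ∈ Icc (0:ℝ) T, V t = v₀ + ∫ s in (0:ℝ)..t, (bb (V s) + sb (V s) * F s) := by
      intro v hv hsol
      have hV : Continuous (IccExtend hT.le ((Icc (0:ℝ) T).domRestrict v)) :=
        (continuousOn_iff_continuous_domRestrict.1 hv).Icc_extend'
      have hvV : ∀ s ∈ Icc (0:ℝ) T, v s = IccExtend hT.le ((Icc (0:ℝ) T).domRestrict v) s :=
        fun s hs => by rw [IccExtend_of_mem hT.le _ hs]; rfl
      refine ⟨_, hV, hvV, fun t ht => ?_⟩
      rw [← hvV t ht, ← hconv v _ hV hvV t ht]; exact hsol t ht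
    intro v w hv hvs hw hws
    obtain ⟨V, hVc, hvV, hV⟩ := key v hv hvs
    obtain ⟨W, hWc, hwW, hW⟩ := key w hw hws
    intro t ht
    rw [hvV t ht, hwW t ht]
    exact huniq V W hVc hWc hV hW ht
end

section
/- Let T > 0, ρ ∈ (−1,1), ρ̄ := √(1−ρ²). Let K satisfy Assumption (K), let U : ℝ → [0,∞) be continuous, let σ : ℝ → (0,∞) be continuous, and let b̄, σ̄ satisfy Assumption (R) with fixed v₀ > 0. For y ∈ ℝ, f ∈ H₀¹[0,T], and a continuous function v : [0,T] → ℝ with v(t) = v₀ + ∫₀^t b̄(v(s)) ds + ∫₀^t σ̄(v(s)) ḟ(s) ds for all t, set w(t) := ∫₀^t K(t,s) U(v(s)) ds, Φ(y,f,v) := ρ̄ (∫₀^T σ(w(s))² ds)^{1/2} y + ρ ∫₀^T σ(w(s)) ḟ(s) ds, and for m ≥ 1 with t_k := kT/m, Φ_m(y,f,v) := ρ̄ (∫₀^T σ(w(s))² ds)^{1/2} y + ρ Σ_{k=0}^{m−1} σ(w(t_k)) (f(t_{k+1}) − f(t_k)). Then for every α > 0, lim_{m→∞} sup { |Φ(y,f,v)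 − Φ_m(y,f,v)| : y ∈ ℝ, f ∈ H₀¹[0,T], v as above, (T/2) y² + ½ ∫₀^T ḟ(s)² ds ≤ α } = 0. -/
open MeasureTheory Set

/-- `w(t) = ∫₀^t K(t,s) U(v(s)) ds`. -/
noncomputable def what (K : ℝ → ℝ → ℝ) (U : ℝ → ℝ) (v : ℝ → ℝ) (t : ℝ) : ℝ :=
  ∫ s in Icc (0:ℝ) t, K t s * U (v s)

/-- `Φ(y,f,v)` (with `ḟ = df`). -/
noncomputable def Phi (T ρ : ℝ) (K : ℝ → ℝ → ℝ) (U σ : ℝ → ℝ)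
    (y : ℝ) (df v : ℝ → ℝ) : ℝ :=
  Real.sqrt (1 - ρ^2) * Real.sqrt (∫ s in Icc (0:ℝ) T, (σ (what K U v s))^2) * y +
    ρ * ∫ s in Icc (0:ℝ) T, σ (what K U v s) * df s

/-- `Φ_m(y,f,v)` with grid points `t_k = kT/m`. -/
noncomputable def Phim (T ρ : ℝ) (K : ℝ → ℝ → ℝ) (U σ : ℝ → ℝ) (m : ℕ)
    (y : ℝ) (f v : ℝ → ℝ) : ℝ :=
  Real.sqrt (1 - ρ^2) * Real.sqrt (∫ s in Icc (0:ℝ) T, (σ (what K U v s))^2) * y +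
    ρ * ∑ k ∈ Finset.range m,
      σ (what K U v ((k : ℝ) * T / m)) * (f (((k : ℝ) + 1) * T / m) - f ((k : ℝ) * T / m))


theorem aux_cs_s11 {X : Type*} [MeasurableSpace X] (ν : Measure X) (f g : X → ℝ)
    (hf : MemLp f 2 ν) (hg : MemLp g 2 ν) :
    (∫ x, |f x| * |g x| ∂ν)^2 ≤ (∫ x, (f x)^2 ∂ν) * (∫ x, (g x)^2 ∂ν) := by
  have h := integral_mul_le_Lp_mul_Lq_of_nonneg (μ := ν) (f := fun x => |f x|)
    (g := fun x => |g x|) Real.HolderConjugate.two_two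
    (Filter.Eventually.of_forall fun x => abs_nonneg _)
    (Filter.Eventually.of_forall fun x => abs_nonneg _)
    (by simpa using hf.norm) (by simpa using hg.norm)
  have e1 : ∀ x : ℝ, |x| ^ (2:ℝ) = x^2 := fun x => by
    rw [show (2:ℝ) = ((2:ℕ):ℝ) by norm_num, Real.rpow_natCast, sq_abs]
  simp only [e1, ← Real.sqrt_eq_rpow] at h
  have h0 : 0 ≤ ∫ x, |f x| * |g x| ∂ν := integral_nonneg fun x => by positivity
  calc _ ≤ (√(∫ x, (f x)^2 ∂ν) * √(∫ x, (g x)^2 ∂ν))^2 := pow_le_pow_left₀ h0 h 2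
    _ = _ := by
      rw [mul_pow, Real.sq_sqrt (integral_nonneg fun x => by positivity),
        Real.sq_sqrt (integral_nonneg fun x => by positivity)]

theorem aux_gron (g : ℝ → ℝ) (hg : Continuous g) (a B T : ℝ) (ha : 0 ≤ a) (hB : 0 ≤ B)
    (h : ∀ t ∈ Icc (0:ℝ) T, g t ≤ a + B * ∫ s in (0:ℝ)..t, g s) :
    ∀ t ∈ Icc (0:ℝ) T, g t ≤ a * Real.exp (B * T) := by
  intro t ht
  have hd : ∀ x, HasDerivAt (fun t => (a + B * ∫ s in (0:ℝ)..t, g s) * Real.exp (-(B*t)))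
      ((B * g x) * Real.exp (-(B*x)) + (a + B * ∫ s in (0:ℝ)..x, g s) *
        (Real.exp (-(B*x)) * (-(B*1)))) x := by
    intro x
    have h1 : HasDerivAt (fun t => ∫ s in (0:ℝ)..t, g s) (g x) x :=
      intervalIntegral.integral_hasDerivAt_right (hg.intervalIntegrable _ _)
        (hg.stronglyMeasurableAtFilter _ _) hg.continuousAt
    exact ((h1.const_mul B).const_add a).mul (((hasDerivAt_id x).const_mul B).neg.exp)
  have anti := antitoneOn_of_deriv_nonpos (convex_Icc 0 T)
    (f := fun t => (a + B * ∫ s in (0:ℝ)..t, g s) * Real.exp (-(B*t)))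
    (fun x _ => (hd x).continuousAt.continuousWithinAt)
    (fun x _ => (hd x).differentiableAt.differentiableWithinAt)
    (fun x hx => by
      rw [(hd x).deriv]
      have h2 := h x (interior_subset hx)
      have h3 := (Real.exp_pos (-(B*x))).le
      have : B * Real.exp (-(B*x)) * (g x - (a + B * ∫ s in (0:ℝ)..x, g s)) ≤ 0 :=
        mul_nonpos_of_nonneg_of_nonpos (by positivity) (by linarith)
      linarith)
  have h4 := anti (left_mem_Icc.2 (ht.1.trans ht.2)) ht ht.1
  simp only [intervalIntegral.integral_same, mul_zero, neg_zero, Real.exp_zero, add_zero,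
    mul_one] at h4
  rw [Real.exp_neg, ← div_eq_mul_inv, div_le_iff₀ (Real.exp_pos _)] at h4
  refine (h t ht).trans (h4.trans ?_)
  exact mul_le_mul_of_nonneg_left (Real.exp_le_exp.2 (mul_le_mul_of_nonneg_left ht.2 hB)) ha

theorem aux_df (T : ℝ) (df : ℝ → ℝ) (hdf : Measurable df)
    (hi : IntegrableOn (fun s => (df s)^2) (Icc (0:ℝ) T)) :
    MemLp df 2 (volume.restrict (Icc (0:ℝ) T)) :=
  (memLp_two_iff_integrable_sq hdf.aestronglyMeasurable).2 hi

theorem aux_arith (x v₀ I J A B Y G μ' D : ℝ) (hx : x = v₀ + I + J) (hI : |I| ≤ A)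
    (hJ : |J| ≤ B) (hcs : (A + B)^2 ≤ μ'^2 * Y * G) (hG : G ≤ D) (hY : 0 ≤ Y) :
    1 + x^2 ≤ 1 + 2 * v₀^2 + 2 * μ'^2 * D * Y := by
  have hIJ : |I + J| ≤ A + B := (abs_add_le _ _).trans (add_le_add hI hJ)
  have hsq : (I+J)^2 ≤ (A+B)^2 := sq_le_sq' (by linarith [(abs_le.1 hIJ).1]) (abs_le.1 hIJ).2
  have h5 : (A+B)^2 ≤ μ'^2 * Y * D :=
    hcs.trans (mul_le_mul_of_nonneg_left hG (by positivity))
  rw [hx]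
  nlinarith [sq_nonneg (v₀ - (I + J))]

theorem aux_v (T : ℝ) (hT : 0 < T) (v₀ μ α : ℝ) (bb sb : ℝ → ℝ)
    (hbgrow : ∀ x : ℝ, (bb x)^2 ≤ μ^2 * (1 + x^2))
    (hsgrow : ∀ x : ℝ, (sb x)^2 ≤ μ^2 * (1 + x^2))
    (df v : ℝ → ℝ) (hdf : Measurable df)
    (hi : IntegrableOn (fun s => (df s)^2) (Icc (0:ℝ) T))
    (hv : ContinuousOn v (Icc (0:ℝ) T))
    (hveq : ∀ t ∈ Icc (0:ℝ) T,
          v t = v₀ + (∫ s in Icc (0:ℝ) t, bb (v s)) + ∫ s in Icc (0:ℝ) t, sb (v s) * df s)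
    (he : (∫ s in Icc (0:ℝ) T, (df s)^2) ≤ 2 * α) :
    ∀ t ∈ Icc (0:ℝ) T, 1 + (v t)^2 ≤ (1 + 2 * v₀^2) * Real.exp (2 * μ^2 * (2*T+4*α) * T) := by
  have hα : 0 ≤ 2 * α := (integral_nonneg fun x => by positivity).trans he
  set p : ℝ → ℝ := fun s => (projIcc 0 T hT.le s : ℝ) with hp
  have hpe : ∀ s ∈ Icc (0:ℝ) T, p s = s := fun s hs => by simp [hp, projIcc_of_mem _ hs]
  have hpm : ∀ s, p s ∈ Icc (0:ℝ) T := fun s => (projIcc 0 T hT.le s).2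
  have hvc : Continuous (fun s => v (p s)) :=
    hv.comp_continuous (continuous_subtype_val.comp continuous_projIcc) hpm
  suffices hg : ∀ t ∈ Icc (0:ℝ) T, 1 + (v (p t))^2 ≤ 1 + 2 * v₀^2 +
      2 * μ^2 * (2*T+4*α) * ∫ s in (0:ℝ)..t, (1 + (v (p s))^2) by
    intro t ht
    have hB : 0 ≤ 2 * μ^2 * (2*T+4*α) := by
      have : 0 ≤ 2*T+4*α := by linarith
      positivity
    have key := aux_gron (fun s => 1 + (v (p s))^2) (continuous_const.add (hvc.pow 2))
      (1 + 2 * v₀^2) (2 * μ^2 * (2*T+4*α)) T (by positivity) hB hg t ht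
    rw [hpe t ht] at key
    exact key
  intro t ht
  have hsub : Icc (0:ℝ) t ⊆ Icc 0 T := Icc_subset_Icc_right ht.2
  set ν := volume.restrict (Icc (0:ℝ) t) with hν
  have hae : ∀ᵐ s ∂ν, s ∈ Icc (0:ℝ) t := ae_restrict_mem measurableSet_Icc
  set F : ℝ → ℝ := fun s => √(μ^2 * (1 + (v (p s))^2)) with hF
  have hFc : Continuous F := (continuous_const.mul (continuous_const.add (hvc.pow 2))).sqrt
  have hF2 : ∀ s, F s ^ 2 = μ^2 * (1 + (v (p s))^2) := fun s => Real.sq_sqrt (by positivity)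
  have hFm : MemLp F 2 ν :=
    (memLp_two_iff_integrable_sq hFc.aestronglyMeasurable).2
      (Continuous.integrableOn_Icc (hFc.pow 2))
  have hdm : MemLp df 2 ν := 
    aux_df t df hdf (hi.mono_set hsub)
  have hdn : MemLp (fun s => |df s|) 2 ν := hdm.norm
  have hone : MemLp (fun _ : ℝ => (1:ℝ)) 2 ν := memLp_const 1
  have hGm : MemLp (fun s => 1 + |df s|) 2 ν := hone.add hdn
  have hI : |∫ s, bb (v s) ∂ν| ≤ ∫ s, F s ∂ν := by
    rw [← Real.norm_eq_abs]
    refine norm_integral_le_of_norm_le hFc.continuousOn.integrableOn_Icc ?_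
    filter_upwards [hae] with s hs
    simp only [hF, hpe s (hsub hs)]
    exact Real.abs_le_sqrt (hbgrow _)
  have hFd : Integrable (fun s => F s * |df s|) ν := by
    exact hFm.integrable_mul hdn
  have hJ : |∫ s, sb (v s) * df s ∂ν| ≤ ∫ s, F s * |df s| ∂ν := by
    rw [← Real.norm_eq_abs]
    refine norm_integral_le_of_norm_le hFd ?_
    filter_upwards [hae] with s hs
    simp only [hF, hpe s (hsub hs), norm_mul, Real.norm_eq_abs]
    exact mul_le_mul_of_nonneg_right (Real.abs_le_sqrt (hsgrow _)) (abs_nonneg _)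
  have hsum : (∫ s, F s ∂ν) + ∫ s, F s * |df s| ∂ν = ∫ s, |F s| * |(1 + |df s|)| ∂ν := by
    rw [← integral_add hFc.continuousOn.integrableOn_Icc hFd]
    congr 1; ext s
    rw [abs_of_nonneg (show 0 ≤ F s from Real.sqrt_nonneg _),
      abs_of_nonneg (show 0 ≤ 1 + |df s| by positivity)]
    ring
  have hcs := aux_cs_s11 ν F (fun s => 1 + |df s|) hFm hGm
  rw [← hsum] at hcs
  have hFi : ∫ s, (F s)^2 ∂ν = μ^2 * ∫ s in (0:ℝ)..t, (1 + (v (p s))^2) := by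
    simp only [hF2]
    rw [integral_const_mul, intervalIntegral.integral_of_le ht.1, hν, integral_Icc_eq_integral_Ioc]
  have hGi : ∫ s, (1 + |df s|)^2 ∂ν ≤ 2*T+4*α := by
    have h1 : ∫ s, (1 + |df s|)^2 ∂ν ≤ ∫ s in Icc (0:ℝ) T, (2 + 2 * (df s)^2) := by
      calc _ ≤ ∫ s, (2 + 2 * (df s)^2) ∂ν := by
            refine integral_mono ((memLp_two_iff_integrable_sq hGm.1).1 hGm) ?_ ?_
            · exact (integrable_const _).add
                (((memLp_two_iff_integrable_sq hdm.1).1 hdm).const_mul 2)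
            · intro s
              have := sq_abs (df s)
              simp only
              nlinarith [sq_nonneg (1 - |df s|)]
        _ ≤ _ := by
            refine setIntegral_mono_set ?_ ?_ (HasSubset.Subset.eventuallyLE hsub)
            · exact (integrable_const _).add (hi.const_mul 2)
            · exact Filter.Eventually.of_forall fun s => by simp only [Pi.zero_apply]; positivity
    rw [integral_add (integrable_const _) (hi.const_mul 2), integral_const_mul] at h1
    simp [hT.le] at h1
    linarith
  rw [hFi] at hcs
  have hv1 := hveq t ht
  have hY : 0 ≤ ∫ s in (0:ℝ)..t, (1 + (v (p s))^2) :=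
    intervalIntegral.integral_nonneg ht.1 fun s _ => by positivity
  simp only [hpe t ht]
  exact aux_arith _ _ _ _ _ _ _ _ _ _ hv1 hI hJ hcs hGi hY

theorem aux_w (T : ℝ) (hT : 0 < T)
    (K : ℝ → ℝ → ℝ) (c r : ℝ)
    (hKmeas : Measurable (Function.uncurry K))
    (hKint : ∀ t ∈ Icc (0:ℝ) T, IntegrableOn (fun s => (K t s)^2) (Icc (0:ℝ) T))
    (CK : ℝ) (hKbdd : ∀ t ∈ Icc (0:ℝ) T, (∫ s in Icc (0:ℝ) T, (K t s)^2) ≤ CK)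
    (hKmoc : ∀ t₁ ∈ Icc (0:ℝ) T, ∀ t₂ ∈ Icc (0:ℝ) T,
      (∫ s in Icc (0:ℝ) T, (K t₁ s - K t₂ s)^2) ≤ c * |t₁ - t₂| ^ r)
    (hKvolterra : ∀ t s : ℝ, 0 ≤ t → t < s → s ≤ T → K t s = 0)
    (U : ℝ → ℝ) (hUcont : Continuous U) (v : ℝ → ℝ) (hv : ContinuousOn v (Icc (0:ℝ) T))
    (M : ℝ) (hM : ∀ s ∈ Icc (0:ℝ) T, |U (v s)| ≤ M) :
    (∀ t ∈ Icc (0:ℝ) T, |what K U v t| ≤ M * (T + CK)) ∧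
    (∀ t₁ ∈ Icc (0:ℝ) T, ∀ t₂ ∈ Icc (0:ℝ) T,
      (what K U v t₁ - what K U v t₂)^2 ≤ (M^2 * T * c) * |t₁ - t₂| ^ r) := by
  have hM0 : 0 ≤ M := (abs_nonneg _).trans (hM 0 ⟨le_rfl, hT.le⟩)
  set ν := volume.restrict (Icc (0:ℝ) T) with hν
  have hae : ∀ᵐ s ∂ν, s ∈ Icc (0:ℝ) T := ae_restrict_mem measurableSet_Icc
  have hUv : ContinuousOn (fun s => U (v s)) (Icc (0:ℝ) T) := hUcont.comp_continuousOn hv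
  have hKm : ∀ t ∈ Icc (0:ℝ) T, MemLp (K t) 2 ν := fun t ht =>
    (memLp_two_iff_integrable_sq (hKmeas.of_uncurry_left).aestronglyMeasurable).2 (hKint t ht)
  have hUm : MemLp (fun s => U (v s)) 2 ν :=
    (memLp_two_iff_integrable_sq (hUv.aestronglyMeasurable measurableSet_Icc)).2
      (hUv.pow 2).integrableOn_Icc
  have hKU : ∀ t ∈ Icc (0:ℝ) T, Integrable (fun s => K t s * U (v s)) ν := fun t ht =>
    (hKm t ht).integrable_mul hUm
  have hw : ∀ t ∈ Icc (0:ℝ) T, what K U v t = ∫ s, K t s * U (v s) ∂ν := by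
    intro t ht
    unfold what
    refine (setIntegral_eq_of_subset_of_forall_sdiff_eq_zero measurableSet_Icc
      (Icc_subset_Icc_right ht.2) ?_).symm
    intro s hs
    have : t < s := by
      by_contra h
      exact hs.2 ⟨hs.1.1, not_lt.1 h⟩
    rw [hKvolterra t s ht.1 this hs.1.2, zero_mul]
  have hvol : ∫ s, (1:ℝ) ∂ν = T := by simp [hν, hT.le]
  constructor
  · intro t ht
    rw [hw t ht]
    have h1 : |∫ s, K t s * U (v s) ∂ν| ≤ ∫ s, M * (1 + (K t s)^2) ∂ν := by
      rw [← Real.norm_eq_abs]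
      refine norm_integral_le_of_norm_le
        (((integrable_const _).add (hKint t ht)).const_mul M) ?_
      filter_upwards [hae] with s hs
      rw [norm_mul, mul_comm, Real.norm_eq_abs, Real.norm_eq_abs]
      refine mul_le_mul (hM s hs) ?_ (abs_nonneg _) hM0
      nlinarith [sq_abs (K t s), sq_nonneg (|K t s| - 1), abs_nonneg (K t s)]
    refine h1.trans ?_
    rw [integral_const_mul, integral_add (integrable_const _) (hKint t ht), hvol]
    exact mul_le_mul_of_nonneg_left (by linarith [hKbdd t ht]) hM0
  · intro t₁ h₁ t₂ h₂
    rw [hw _ h₁, hw _ h₂, ← integral_sub (hKU _ h₁) (hKU _ h₂)]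
    have hD : MemLp (fun s => K t₁ s - K t₂ s) 2 ν := (hKm _ h₁).sub (hKm _ h₂)
    have hcs := aux_cs_s11 ν (fun _ => M) (fun s => K t₁ s - K t₂ s) (memLp_const M) hD
    have h1 : |∫ s, (K t₁ s * U (v s) - K t₂ s * U (v s)) ∂ν| ≤
        ∫ s, |M| * |K t₁ s - K t₂ s| ∂ν := by
      rw [← Real.norm_eq_abs]
      refine norm_integral_le_of_norm_le
        ((hD.norm.integrable (by norm_num)).const_mul _) ?_
      filter_upwards [hae] with s hs
      rw [← sub_mul, norm_mul, mul_comm, Real.norm_eq_abs, Real.norm_eq_abs, abs_of_nonneg hM0]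
      exact mul_le_mul_of_nonneg_right (hM s hs) (abs_nonneg _)
    have h2 := sq_le_sq' (by linarith [(abs_le.1 h1).1]) (abs_le.1 h1).2
    refine h2.trans (hcs.trans ?_)
    have h3 : ∫ _s, M^2 ∂ν = M^2 * T := by
      rw [← hvol, ← integral_const_mul]; simp
    rw [h3, mul_assoc _ c]
    exact mul_le_mul_of_nonneg_left (hKmoc _ h₁ _ h₂) (by positivity)

theorem aux_sum (T : ℝ) (hT : 0 < T) (φ f df : ℝ → ℝ) (hφ : ContinuousOn φ (Icc (0:ℝ) T))
    (hdf : IntegrableOn df (Icc (0:ℝ) T))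
    (hf : ∀ t ∈ Icc (0:ℝ) T, f t = ∫ s in Icc (0:ℝ) t, df s) (η : ℝ)
    (m : ℕ) (hm : 0 < m)
    (h : ∀ s ∈ Icc (0:ℝ) T, ∀ t ∈ Icc (0:ℝ) T, |s - t| ≤ T / m → |φ s - φ t| ≤ η) :
    |(∫ s in Icc (0:ℝ) T, φ s * df s) - ∑ k ∈ Finset.range m,
      φ ((k : ℝ) * T / m) * (f (((k : ℝ) + 1) * T / m) - f ((k : ℝ) * T / m))| ≤
      η * ∫ s in Icc (0:ℝ) T, |df s| := by
  have hm' : (0:ℝ) < m := by exact_mod_cast hm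
  set t : ℕ → ℝ := fun k => (k : ℝ) * T / m with ht
  have ht1 : ∀ k : ℕ, ((k : ℝ) + 1) * T / m = t (k+1) := fun k => by simp [ht]
  have htstep : ∀ k, t (k+1) = t k + T / m := fun k => by
    simp only [ht]; push_cast; ring
  have hTm : 0 < T / m := by positivity
  have htmem : ∀ k ≤ m, t k ∈ Icc (0:ℝ) T := fun k hk => by
    refine ⟨by positivity, ?_⟩
    have : (k:ℝ) ≤ m := by exact_mod_cast hk
    simp only [ht]
    rw [div_le_iff₀ hm', mul_comm]
    exact mul_le_mul_of_nonneg_left this hT.le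
  have htm : t m = T := by simp only [ht]; field_simp
  have ht0 : t 0 = 0 := by simp [ht]
  have hsub : ∀ a ∈ Icc (0:ℝ) T, ∀ b ∈ Icc (0:ℝ) T, uIcc a b ⊆ Icc (0:ℝ) T :=
    fun a ha b hb => uIcc_subset_Icc ha hb
  have hφd : IntegrableOn (fun s => φ s * df s) (Icc (0:ℝ) T) :=
    hdf.continuousOn_mul hφ isCompact_Icc
  have ii : ∀ g : ℝ → ℝ, IntegrableOn g (Icc (0:ℝ) T) → ∀ a ∈ Icc (0:ℝ) T, ∀ b ∈ Icc (0:ℝ) T,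
      IntervalIntegrable g volume a b := fun g hg a ha b hb =>
    (hg.mono_set (hsub a ha b hb)).intervalIntegrable
  have conv : ∀ g : ℝ → ℝ, ∀ b, 0 ≤ b → ∫ s in Icc (0:ℝ) b, g s = ∫ s in (0:ℝ)..b, g s :=
    fun g b hb => by rw [integral_Icc_eq_integral_Ioc, intervalIntegral.integral_of_le hb]
  have h0 : (0:ℝ) ∈ Icc (0:ℝ) T := ⟨le_rfl, hT.le⟩
  have split : ∀ g : ℝ → ℝ, IntegrableOn g (Icc (0:ℝ) T) →
      ∫ s in Icc (0:ℝ) T, g s = ∑ k ∈ Finset.range m, ∫ s in t k..t (k+1), g s := by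
    intro g hg
    rw [conv g T hT.le, intervalIntegral.sum_integral_adjacent_intervals, ht0, htm]
    intro k hk
    exact ii g hg _ (htmem k hk.le) _ (htmem (k+1) hk)
  have hdiff : ∀ k < m, f (t (k+1)) - f (t k) = ∫ s in t k..t (k+1), df s := by
    intro k hk
    have ha := htmem k hk.le
    have hb := htmem (k+1) hk
    rw [hf _ ha, hf _ hb, conv _ _ ha.1, conv _ _ hb.1]
    exact intervalIntegral.integral_interval_sub_left (ii df hdf _ h0 _ hb) (ii df hdf _ h0 _ ha)
  have habs : IntegrableOn (fun s => |df s|) (Icc (0:ℝ) T) := hdf.norm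
  rw [split _ hφd, split _ habs, ← Finset.sum_sub_distrib, Finset.mul_sum]
  refine (Finset.abs_sum_le_sum_abs _ _).trans (Finset.sum_le_sum fun k hk => ?_)
  have hk := Finset.mem_range.1 hk
  have ha := htmem k hk.le
  have hb := htmem (k+1) hk
  have hab : t k ≤ t (k+1) := by rw [htstep]; linarith
  rw [ht1, show (k:ℝ) * T / m = t k from rfl, hdiff k hk,
    ← intervalIntegral.integral_const_mul, ← intervalIntegral.integral_const_mul,
    ← intervalIntegral.integral_sub (ii _ hφd _ ha _ hb) ((ii _ hdf _ ha _ hb).const_mul _)]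
  rw [← Real.norm_eq_abs]
  refine intervalIntegral.norm_integral_le_of_norm_le hab ?_ ((ii _ habs _ ha _ hb).const_mul _)
  refine Filter.Eventually.of_forall fun s hs => ?_
  rw [← sub_mul, norm_mul, Real.norm_eq_abs, Real.norm_eq_abs]
  refine mul_le_mul_of_nonneg_right (h s ⟨ha.1.trans hs.1.le, hs.2.trans hb.2⟩ _ ha ?_)
    (abs_nonneg _)
  rw [abs_of_nonneg (by linarith [hs.1])]
  have := hs.2
  rw [htstep] at this
  linarith

/-- uniform convergence, on sub-level sets of the energy, of the
discretized functionals `Φ_m` to `Φ` (key step for the extended contraction principle). -/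
theorem Phim_uniform_approximation
    (T : ℝ) (hT : 0 < T) (ρ : ℝ) (hρ : ρ ∈ Ioo (-1:ℝ) 1)
    (K : ℝ → ℝ → ℝ) (c r : ℝ) (hc : 0 < c) (hr : 0 < r)
    (hKmeas : Measurable (Function.uncurry K))
    (hKint : ∀ t ∈ Icc (0:ℝ) T, IntegrableOn (fun s => (K t s)^2) (Icc (0:ℝ) T))
    (CK : ℝ) (hKbdd : ∀ t ∈ Icc (0:ℝ) T, (∫ s in Icc (0:ℝ) T, (K t s)^2) ≤ CK)
    (hKmoc : ∀ t₁ ∈ Icc (0:ℝ) T, ∀ t₂ ∈ Icc (0:ℝ) T,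
      (∫ s in Icc (0:ℝ) T, (K t₁ s - K t₂ s)^2) ≤ c * |t₁ - t₂| ^ r)
    (hKvolterra : ∀ t s : ℝ, 0 ≤ t → t < s → s ≤ T → K t s = 0)
    (U : ℝ → ℝ) (hUcont : Continuous U) (hUnonneg : ∀ x, 0 ≤ U x)
    (σ : ℝ → ℝ) (hσcont : Continuous σ) (hσpos : ∀ x, 0 < σ x)
    (v₀ : ℝ) (hv₀ : 0 < v₀) (μ : ℝ) (hμ : 0 < μ)
    (bb sb : ℝ → ℝ)
    (hbgrow : ∀ x : ℝ, (bb x)^2 ≤ μ^2 * (1 + x^2))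
    (hsgrow : ∀ x : ℝ, (sb x)^2 ≤ μ^2 * (1 + x^2))
    (hblip : LocallyLipschitz bb) (hb0 : 0 < bb 0)
    (hsnonneg : ∀ x : ℝ, 0 ≤ sb x)
    (hslip : ∀ x : ℝ, x ≠ 0 → ∃ u ∈ nhds x, ∃ L : NNReal, LipschitzOnWith L sb u)
    (hs0 : sb 0 = 0) (hspos : ∀ x : ℝ, x ≠ 0 → 0 < sb x)
    (γ : ℝ → ℝ) (hγcont : ContinuousOn γ (Ioi (0:ℝ)))
    (hγmono : MonotoneOn γ (Ioi (0:ℝ)))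
    (hγpos : ∀ u : ℝ, 0 < u → 0 < γ u)
    (hγint : ∀ ε : ℝ, 0 < ε → ¬ IntegrableOn (fun u => 1 / (γ u)^2) (Ioc (0:ℝ) ε))
    (hγbound : ∀ x y : ℝ, x ≠ y → |sb x - sb y| ≤ γ |x - y|)
    (α : ℝ) (hα : 0 < α) :
    ∀ ε : ℝ, 0 < ε → ∃ N : ℕ, ∀ m : ℕ, N ≤ m →
      ∀ (y : ℝ) (f df v : ℝ → ℝ),
        Measurable df → IntegrableOn (fun s => (df s)^2) (Icc (0:ℝ) T) →
        (∀ t ∈ Icc (0:ℝ) T, f t = ∫ s in Icc (0:ℝ) t, df s) →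
        ContinuousOn v (Icc (0:ℝ) T) →
        (∀ t ∈ Icc (0:ℝ) T,
          v t = v₀ + (∫ s in Icc (0:ℝ) t, bb (v s)) + ∫ s in Icc (0:ℝ) t, sb (v s) * df s) →
        (T / 2) * y^2 + (1/2) * (∫ s in Icc (0:ℝ) T, (df s)^2) ≤ α →
        |Phi T ρ K U σ y df v - Phim T ρ K U σ m y f v| ≤ ε := by
  intro ε hε
  set R2 : ℝ := (1 + 2 * v₀^2) * Real.exp (2 * μ^2 * (2*T+4*α) * T) with hR2
  obtain ⟨M, hM⟩ := (isCompact_Icc (a := -√R2) (b := √R2)).exists_bound_of_continuousOn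
    hUcont.continuousOn
  set W : ℝ := M * (T + CK) with hW
  have hu := (isCompact_Icc (a := -W) (b := W)).uniformContinuousOn_of_continuous
    hσcont.continuousOn
  rw [Metric.uniformContinuousOn_iff] at hu
  have hTα : 0 < T + 2 * α := by positivity
  obtain ⟨δ, hδ, hσδ⟩ := hu (ε / (T + 2 * α)) (by positivity)
  -- modulus of `w`
  have hmod : ∃ h > 0, ∀ x : ℝ, 0 ≤ x → x ≤ h → (M^2 * T * c) * x ^ r < δ^2 := by
    have ht : Filter.Tendsto (fun x : ℝ => (M^2 * T * c) * x ^ r) (nhds 0) (nhds 0) := by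
      have : ContinuousAt (fun x : ℝ => (M^2 * T * c) * x ^ r) 0 :=
        continuousAt_const.mul (Real.continuousAt_rpow_const 0 r (Or.inr hr.le))
      simpa [ContinuousAt, Real.zero_rpow hr.ne'] using this
    have h2 := ht.eventually (gt_mem_nhds (show (0:ℝ) < δ^2 by positivity))
    obtain ⟨h, hh, hb⟩ := Metric.eventually_nhds_iff.1 h2
    refine ⟨h / 2, by positivity, fun x hx hxh => hb ?_⟩
    rw [Real.dist_eq, sub_zero, abs_of_nonneg hx]
    linarith
  obtain ⟨h, hh, hmod⟩ := hmod
  obtain ⟨N, hN⟩ := exists_nat_gt (T / h)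
  refine ⟨N + 1, fun m hm y f df v hdf hdi hf hv hveq he => ?_⟩
  have hm0 : 0 < m := by omega
  have hm' : (0:ℝ) < m := by exact_mod_cast hm0
  have hTm : T / m ≤ h := by
    rw [div_le_iff₀ hm', mul_comm, ← div_le_iff₀ hh]
    have : (N:ℝ) ≤ m := by exact_mod_cast (by omega : N ≤ m)
    linarith
  have he2 : (∫ s in Icc (0:ℝ) T, (df s)^2) ≤ 2 * α := by
    have : 0 ≤ (T / 2) * y^2 := by positivity
    linarith
  have hvb := aux_v T hT v₀ μ α bb sb hbgrow hsgrow df v hdf hdi hv hveq he2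
  have hUb : ∀ s ∈ Icc (0:ℝ) T, |U (v s)| ≤ M := by
    intro s hs
    refine hM (v s) ?_
    have := Real.abs_le_sqrt (x := v s) (y := R2) (by linarith [hvb s hs])
    exact ⟨(abs_le.1 this).1, (abs_le.1 this).2⟩
  obtain ⟨hwb, hwm⟩ := aux_w T hT K c r hKmeas hKint CK hKbdd hKmoc hKvolterra U hUcont v hv M hUb
  have hwc : ContinuousOn (what K U v) (Icc (0:ℝ) T) := by
    intro t ht
    rw [ContinuousWithinAt, tendsto_iff_dist_tendsto_zero]
    have h1 : Filter.Tendsto (fun x : ℝ => √((M^2 * T * c) * |x - t| ^ r))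
        (nhdsWithin t (Icc 0 T)) (nhds 0) := by
      have : ContinuousAt (fun x : ℝ => √((M^2 * T * c) * |x - t| ^ r)) t := by
        refine (continuousAt_const.mul ?_).sqrt
        exact ContinuousAt.rpow_const (by fun_prop) (Or.inr hr.le)
      have h2 : Filter.Tendsto (fun x : ℝ => √((M^2 * T * c) * |x - t| ^ r)) (nhds t) (nhds 0) := by
        simpa [ContinuousAt, Real.zero_rpow hr.ne'] using this
      exact h2.mono_left nhdsWithin_le_nhds
    refine squeeze_zero' (Filter.Eventually.of_forall fun _ => dist_nonneg) ?_ h1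
    filter_upwards [self_mem_nhdsWithin] with x hx
    exact Real.abs_le_sqrt (hwm x hx t ht)
  have hdf1 : IntegrableOn df (Icc (0:ℝ) T) := (aux_df T df hdf hdi).integrable (by norm_num)
  have key := aux_sum T hT (fun s => σ (what K U v s)) f df (hσcont.comp_continuousOn hwc)
    hdf1 hf (ε / (T + 2 * α)) m hm0 (by
      intro s hs t ht hst
      have h1 : |what K U v s - what K U v t| < δ :=
        abs_lt_of_sq_lt_sq ((hwm s hs t ht).trans_lt
          (hmod _ (abs_nonneg _) (hst.trans hTm))) hδ.le
      exact (hσδ _ (abs_le.1 (hwb s hs)) _ (abs_le.1 (hwb t ht)) h1).le)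
  have hdfb : ∫ s in Icc (0:ℝ) T, |df s| ≤ T + 2 * α := by
    have h1 : ∫ s in Icc (0:ℝ) T, |df s| ≤ ∫ s in Icc (0:ℝ) T, (1 + (df s)^2) := by
      refine integral_mono hdf1.norm ((integrable_const _).add hdi) fun s => ?_
      simp only [Real.norm_eq_abs]
      nlinarith [sq_abs (df s), sq_nonneg (|df s| - 1), abs_nonneg (df s)]
    rw [integral_add (integrable_const _) hdi] at h1
    simp [hT.le] at h1
    linarith
  have hρ1 : |ρ| ≤ 1 := (abs_lt.2 hρ).le
  unfold Phi Phim
  rw [add_sub_add_left_eq_sub, ← mul_sub, abs_mul]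
  calc _ ≤ 1 * (ε / (T + 2 * α) * (T + 2 * α)) :=
        mul_le_mul hρ1 (key.trans (mul_le_mul_of_nonneg_left hdfb (by positivity)))
          (abs_nonneg _) zero_le_one
    _ = ε := by field_simp
end

section
/- Work on [0,1] with a kernel K satisfying Assumption (K), and let σ : ℝ → (0,∞) be continuously differentiable. Then for all continuous f, g : [0,1] → ℝ, the function δ ↦ ∫₀¹ σ( 𝒦((f+δg)²)(s) )² ds is differentiable at δ = 0 with derivative 2 ∫₀¹ (σ²)′( 𝒦(f²)(s) ) · 𝒦(fg)(s) ds, where (σ²)′ denotes the derivative of x ↦ σ(x)². -/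
open MeasureTheory Set

/-- `𝒦(fg)(t) = ∫₀^t K(t,s) f(s) g(s) ds` (Volterra integral transform on `[0,1]`). -/
noncomputable def Kop (K : ℝ → ℝ → ℝ) (f g : ℝ → ℝ) (t : ℝ) : ℝ :=
  ∫ s in Icc (0:ℝ) t, K t s * (f s * g s)

lemma kop_aux_int (K : ℝ → ℝ → ℝ) 
    (hKmeas : Measurable (Function.uncurry K))
    (hKint : ∀ t ∈ Icc (0:ℝ) 1, IntegrableOn (fun s => (K t s)^2) (Icc (0:ℝ) 1))
    (h : ℝ → ℝ) (hh : ContinuousOn h (Icc (0:ℝ) 1)) (t : ℝ) (ht : t ∈ Icc (0:ℝ) 1) :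
    IntegrableOn (fun s => K t s * h s) (Icc (0:ℝ) 1) := by
  obtain ⟨C, hC⟩ := isCompact_Icc.exists_bound_of_continuousOn hh
  have hm : Measurable (K t) := hKmeas.of_uncurry_left
  have h1 : IntegrableOn (fun s => (1 + (K t s)^2) * C) (Icc (0:ℝ) 1) :=
    (((integrable_const (1:ℝ)).add (hKint t ht))).mul_const C
  refine Integrable.mono' h1 
    (hm.aestronglyMeasurable.mul (hh.aestronglyMeasurable measurableSet_Icc)) ?_
  refine (ae_restrict_iff' measurableSet_Icc).2 (Filter.Eventually.of_forall fun s hs => ?_)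
  rw [norm_mul]
  have h2 : ‖K t s‖ ≤ 1 + (K t s)^2 := by
    rw [Real.norm_eq_abs, ← sq_abs]; nlinarith [sq_nonneg (|K t s| - 1), abs_nonneg (K t s)]
  exact mul_le_mul h2 (hC s hs) (norm_nonneg _) (by positivity)

lemma kop_aux_eq (K : ℝ → ℝ → ℝ)
    (hKvolterra : ∀ t s : ℝ, 0 ≤ t → t < s → s ≤ 1 → K t s = 0)
    (φ ψ : ℝ → ℝ) (t : ℝ) (ht : t ∈ Icc (0:ℝ) 1) :
    Kop K φ ψ t = ∫ s in Icc (0:ℝ) 1, K t s * (φ s * ψ s) := by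
  unfold Kop
  refine (setIntegral_eq_of_subset_of_forall_sdiff_eq_zero measurableSet_Icc
    (Icc_subset_Icc_right ht.2) ?_)|>.symm
  intro s hs
  have : t < s := by
    by_contra hcon
    exact hs.2 ⟨hs.1.1, not_lt.1 hcon⟩
  rw [hKvolterra t s ht.1 this hs.1.2, zero_mul]

lemma kop_aux_bdd (K : ℝ → ℝ → ℝ)
    (hKint : ∀ t ∈ Icc (0:ℝ) 1, IntegrableOn (fun s => (K t s)^2) (Icc (0:ℝ) 1))
    (CK : ℝ) (hKbdd : ∀ t ∈ Icc (0:ℝ) 1, (∫ s in Icc (0:ℝ) 1, (K t s)^2) ≤ CK)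
    (hKvolterra : ∀ t s : ℝ, 0 ≤ t → t < s → s ≤ 1 → K t s = 0)
    (φ ψ : ℝ → ℝ) (hh : ContinuousOn (fun s => φ s * ψ s) (Icc (0:ℝ) 1)) :
    ∃ M, ∀ t ∈ Icc (0:ℝ) 1, |Kop K φ ψ t| ≤ M := by
  obtain ⟨C, hC⟩ := isCompact_Icc.exists_bound_of_continuousOn hh
  have hC0 : 0 ≤ C := (norm_nonneg _).trans (hC 0 (by simp))
  refine ⟨(1 + CK) * C, fun t ht => ?_⟩
  rw [kop_aux_eq K hKvolterra φ ψ t ht]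
  have h1 : IntegrableOn (fun s => (1 + (K t s)^2) * C) (Icc (0:ℝ) 1) :=
    (((integrable_const (1:ℝ)).add (hKint t ht))).mul_const C
  have h3 := norm_integral_le_of_norm_le h1 (f := fun s => K t s * (φ s * ψ s)) (by
    refine (ae_restrict_iff' measurableSet_Icc).2 (Filter.Eventually.of_forall fun s hs => ?_)
    rw [norm_mul]
    have h2 : ‖K t s‖ ≤ 1 + (K t s)^2 := by
      rw [Real.norm_eq_abs, ← sq_abs]; nlinarith [sq_nonneg (|K t s| - 1), abs_nonneg (K t s)]
    exact mul_le_mul h2 (hC s hs) (norm_nonneg _) (by positivity))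
  rw [Real.norm_eq_abs] at h3
  refine h3.trans ?_
  rw [integral_mul_const, integral_add (integrable_const (1:ℝ)) (hKint t ht)]
  refine mul_le_mul_of_nonneg_right ?_ hC0
  have := hKbdd t ht
  simp
  linarith

lemma kop_aux_meas (K : ℝ → ℝ → ℝ)
    (hKmeas : Measurable (Function.uncurry K))
    (hKvolterra : ∀ t s : ℝ, 0 ≤ t → t < s → s ≤ 1 → K t s = 0)
    (φ ψ : ℝ → ℝ) (hh : ContinuousOn (fun s => φ s * ψ s) (Icc (0:ℝ) 1)) :
    AEStronglyMeasurable (Kop K φ ψ) (volume.restrict (Icc (0:ℝ) 1)) := by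
  have hm := (hh.aestronglyMeasurable (μ := volume) measurableSet_Icc)
  obtain ⟨h, hmeas, hae⟩ := hm
  have h1 : StronglyMeasurable (fun p : ℝ × ℝ => K p.1 p.2 * h p.2) :=
    (hKmeas.mul (hmeas.measurable.comp measurable_snd)).stronglyMeasurable
  have h2 := h1.integral_prod_right' (ν := volume.restrict (Icc (0:ℝ) 1))
  refine h2.aestronglyMeasurable.congr ?_
  refine (ae_restrict_iff' measurableSet_Icc).2 (Filter.Eventually.of_forall fun t ht => ?_)
  rw [kop_aux_eq K hKvolterra φ ψ t ht]
  refine integral_congr_ae ?_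
  filter_upwards [hae] with s hs
  simp only [hs]

/-- differentiability at `δ = 0` of
`δ ↦ ∫₀¹ σ(𝒦((f+δg)²)(s))² ds`, with derivative
`2 ∫₀¹ (σ²)′(𝒦(f²)(s)) 𝒦(fg)(s) ds`. -/
theorem Ftilde_gateaux_derivative
    (K : ℝ → ℝ → ℝ) (c r : ℝ) (hc : 0 < c) (hr : 0 < r)
    (hKmeas : Measurable (Function.uncurry K))
    (hKint : ∀ t ∈ Icc (0:ℝ) 1, IntegrableOn (fun s => (K t s)^2) (Icc (0:ℝ) 1))
    (CK : ℝ) (hKbdd : ∀ t ∈ Icc (0:ℝ) 1, (∫ s in Icc (0:ℝ) 1, (K t s)^2) ≤ CK)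
    (hKmoc : ∀ t₁ ∈ Icc (0:ℝ) 1, ∀ t₂ ∈ Icc (0:ℝ) 1,
      (∫ s in Icc (0:ℝ) 1, (K t₁ s - K t₂ s)^2) ≤ c * |t₁ - t₂| ^ r)
    (hKvolterra : ∀ t s : ℝ, 0 ≤ t → t < s → s ≤ 1 → K t s = 0)
    (σ : ℝ → ℝ) (hσ : ContDiff ℝ 1 σ) (hσpos : ∀ x, 0 < σ x)
    (f g : ℝ → ℝ) (hf : ContinuousOn f (Icc (0:ℝ) 1))
    (hg : ContinuousOn g (Icc (0:ℝ) 1)) :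
    HasDerivAt
      (fun δ : ℝ => ∫ s in Icc (0:ℝ) 1,
        (σ (Kop K (fun u => f u + δ * g u) (fun u => f u + δ * g u) s))^2)
      (2 * ∫ s in Icc (0:ℝ) 1,
        deriv (fun x => (σ x)^2) (Kop K f f s) * Kop K f g s)
      0 := by
  have hff : ContinuousOn (fun s => f s * f s) (Icc (0:ℝ) 1) := hf.mul hf
  have hfg : ContinuousOn (fun s => f s * g s) (Icc (0:ℝ) 1) := hf.mul hg
  have hgg : ContinuousOn (fun s => g s * g s) (Icc (0:ℝ) 1) := hg.mul hg
  have key : ∀ δ : ℝ, ∀ t ∈ Icc (0:ℝ) 1,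
      Kop K (fun u => f u + δ * g u) (fun u => f u + δ * g u) t
        = Kop K f f t + (2 * δ) * Kop K f g t + δ^2 * Kop K g g t := by
    intro δ t ht
    simp only [kop_aux_eq K hKvolterra _ _ t ht]
    have i1 := kop_aux_int K hKmeas hKint _ hff t ht
    have i2 := (kop_aux_int K hKmeas hKint _ hfg t ht).const_mul (2 * δ)
    have i3 := (kop_aux_int K hKmeas hKint _ hgg t ht).const_mul (δ^2)
    have i12 : Integrable (fun s => K t s * (f s * f s) + 2 * δ * (K t s * (f s * g s)))
        (volume.restrict (Icc (0:ℝ) 1)) := i1.add i2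
    rw [← integral_const_mul, ← integral_const_mul, ← integral_add i1 i2,
      ← integral_add i12 i3]
    refine integral_congr_ae (Filter.Eventually.of_forall fun s => ?_)
    ring
  have mff := kop_aux_meas K hKmeas hKvolterra f f hff
  have mfg := kop_aux_meas K hKmeas hKvolterra f g hfg
  have mgg := kop_aux_meas K hKmeas hKvolterra g g hgg
  obtain ⟨A, hA⟩ := kop_aux_bdd K hKint CK hKbdd hKvolterra f f hff
  obtain ⟨B, hB⟩ := kop_aux_bdd K hKint CK hKbdd hKvolterra f g hfg
  obtain ⟨D, hD⟩ := kop_aux_bdd K hKint CK hKbdd hKvolterra g g hgg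
  generalize Kop K f f = a at *
  generalize Kop K f g = b at *
  generalize Kop K g g = d at *
  have hS : ContDiff ℝ 1 (fun x => (σ x)^2) := hσ.pow 2
  have hfun : (fun δ : ℝ => ∫ s in Icc (0:ℝ) 1,
        (σ (Kop K (fun u => f u + δ * g u) (fun u => f u + δ * g u) s))^2)
      = fun δ : ℝ => ∫ s in Icc (0:ℝ) 1, (fun x => (σ x)^2) (a s + (2 * δ) * b s + δ^2 * d s) := by
    funext δ
    refine setIntegral_congr_fun measurableSet_Icc fun t ht => ?_
    simp only [key δ t ht]
  rw [hfun]
  generalize (fun x => (σ x)^2) = S at *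
  have hS' : Continuous (deriv S) := hS.continuous_deriv le_rfl
  have harg : ∀ δ ∈ Metric.ball (0:ℝ) 1, ∀ t ∈ Icc (0:ℝ) 1,
      |a t + (2 * δ) * b t + δ^2 * d t| ≤ A + 2 * B + D ∧ |2 * b t + 2 * δ * d t| ≤ 2 * B + 2 * D := by
    intro δ hδ t ht
    have hδ' : |δ| ≤ 1 := by simpa using (Metric.mem_ball.1 hδ).le
    have hb : |δ * b t| ≤ B := by
      rw [abs_mul]; nlinarith [hB t ht, abs_nonneg (b t), abs_nonneg δ]
    have hd : |δ * d t| ≤ D := by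
      rw [abs_mul]; nlinarith [hD t ht, abs_nonneg (d t), abs_nonneg δ]
    have hd2 : |δ * (δ * d t)| ≤ D := by
      rw [abs_mul]; nlinarith [abs_nonneg (δ * d t), abs_nonneg δ]
    have e1 := abs_le.1 (hA t ht)
    have e2 := abs_le.1 (hB t ht)
    have e4 := abs_le.1 hb
    have e5 := abs_le.1 hd
    have e6 := abs_le.1 hd2
    constructor <;> rw [abs_le] <;> constructor <;> nlinarith
  obtain ⟨C, hC⟩ := (isCompact_Icc (a := -(A + 2 * B + D)) (b := A + 2 * B + D)).exists_bound_of_continuousOn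
    hS'.continuousOn
  obtain ⟨C', hC'⟩ := (isCompact_Icc (a := -(A + 2 * B + D)) (b := A + 2 * B + D)).exists_bound_of_continuousOn
    hS.continuous.continuousOn
  have marg : ∀ δ : ℝ, AEStronglyMeasurable (fun t => a t + (2 * δ) * b t + δ^2 * d t)
      (volume.restrict (Icc (0:ℝ) 1)) := fun δ =>
    (mff.add (mfg.const_mul (2 * δ))).add (mgg.const_mul (δ^2))
  have h0 : (0:ℝ) ∈ Metric.ball (0:ℝ) 1 := by simp
  have main := hasDerivAt_integral_of_dominated_loc_of_deriv_le
    (μ := volume.restrict (Icc (0:ℝ) 1))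
    (F := fun δ t => S (a t + (2 * δ) * b t + δ^2 * d t))
    (F' := fun δ t => deriv S (a t + (2 * δ) * b t + δ^2 * d t) * (2 * b t + 2 * δ * d t))
    (x₀ := (0:ℝ)) (s := Metric.ball (0:ℝ) 1) (bound := fun _ => C * (2 * B + 2 * D))
    (Metric.ball_mem_nhds _ one_pos)
    (Filter.Eventually.of_forall fun δ => hS.continuous.comp_aestronglyMeasurable (marg δ))
    (by
      refine Integrable.mono' (integrable_const C')
        (hS.continuous.comp_aestronglyMeasurable (marg 0)) ?_
      refine (ae_restrict_iff' measurableSet_Icc).2 (Filter.Eventually.of_forall fun t ht => ?_)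
      exact hC' _ (abs_le.1 (harg 0 h0 t ht).1))
    ((hS'.comp_aestronglyMeasurable (marg 0)).mul
      ((mfg.const_mul 2).add (mgg.const_mul (2 * 0))))
    (by
      refine (ae_restrict_iff' measurableSet_Icc).2 (Filter.Eventually.of_forall fun t ht δ hδ => ?_)
      rw [norm_mul]
      have e := hC _ (abs_le.1 (harg δ hδ t ht).1)
      exact mul_le_mul e (harg δ hδ t ht).2 (norm_nonneg _) ((norm_nonneg _).trans e))
    (integrable_const _)
    (by
      refine Filter.Eventually.of_forall fun t δ _ => ?_
      have hd1 : HasDerivAt (fun δ : ℝ => a t + (2 * δ) * b t + δ^2 * d t)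
          (2 * b t + 2 * δ * d t) δ := by
        have q1 := (((hasDerivAt_id δ).const_mul 2).mul_const (b t)).const_add (a t)
        have q2 := ((hasDerivAt_id δ).pow 2).mul_const (d t)
        refine (q1.add q2).congr_deriv ?_
        simp
      exact ((hS.differentiable one_ne_zero _).hasDerivAt).comp δ hd1)
  refine main.2.congr_deriv (Eq.symm ?_)
  rw [← integral_const_mul]
  refine integral_congr_ae (Filter.Eventually.of_forall fun t => ?_)
  simp only [mul_zero, zero_mul, add_zero, ne_eq, OfNat.ofNat_ne_zero, not_false_eq_true, zero_pow]
  ring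
end

section
/- Work on [0,1] with a kernel K satisfying Assumption (K), and let σ : ℝ → (0,∞) be continuously differentiable. Then for all f, g ∈ H₀¹[0,1], the function δ ↦ ∫₀¹ σ( 𝒦((f+δg)²)(s) ) (ḟ(s) + δ ġ(s)) ds is differentiable at δ = 0 with derivative ∫₀¹ σ( 𝒦(f²)(s) ) ġ(s) ds + 2 ∫₀¹ σ′( 𝒦(f²)(s) ) ḟ(s) 𝒦(fg)(s) ds. -/
open MeasureTheory Set

lemma aux_ext (f df : ℝ → ℝ) (hm : Measurable df)
    (h2 : IntegrableOn (fun s => (df s)^2) (Icc (0:ℝ) 1))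
    (hf : ∀ t ∈ Icc (0:ℝ) 1, f t = ∫ s in Icc (0:ℝ) t, df s) :
    IntegrableOn df (Icc (0:ℝ) 1) ∧ ∃ F : ℝ → ℝ, Continuous F ∧ EqOn f F (Icc 0 1) := by
  have hi : IntegrableOn df (Icc (0:ℝ) 1) := by
    have h1 : IntegrableOn (fun _ : ℝ => (1:ℝ)) (Icc (0:ℝ) 1) := by simp
    refine Integrable.mono' (h1.add h2) hm.aestronglyMeasurable (Filter.Eventually.of_forall ?_)
    intro s
    simp only [Real.norm_eq_abs, Pi.add_apply]
    nlinarith [sq_abs (df s), sq_nonneg (|df s| - 1), abs_nonneg (df s)]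
  refine ⟨hi, IccExtend (zero_le_one (α := ℝ)) ((Icc (0:ℝ) 1).domRestrict f), ?_, ?_⟩
  · have hc : ContinuousOn f (Icc (0:ℝ) 1) :=
      (intervalIntegral.continuousOn_primitive_Icc hi).congr hf
    exact hc.domRestrict.Icc_extend'
  · intro t ht
    rw [IccExtend_of_mem _ _ ht]; rfl

lemma aux_kop (K : ℝ → ℝ → ℝ)
    (hKmeas : Measurable (Function.uncurry K))
    (hKint : ∀ t ∈ Icc (0:ℝ) 1, IntegrableOn (fun s => (K t s)^2) (Icc (0:ℝ) 1))
    (CK : ℝ) (hKbdd : ∀ t ∈ Icc (0:ℝ) 1, (∫ s in Icc (0:ℝ) 1, (K t s)^2) ≤ CK)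
    (f g F G : ℝ → ℝ) (hF : Continuous F) (hG : Continuous G)
    (hfF : EqOn f F (Icc 0 1)) (hgG : EqOn g G (Icc 0 1)) :
    (∀ t ∈ Icc (0:ℝ) 1, IntegrableOn (fun s => K t s * (f s * g s)) (Icc 0 t)) ∧
    (∃ M, ∀ t ∈ Icc (0:ℝ) 1, |Kop K f g t| ≤ M) ∧
    AEStronglyMeasurable (Kop K f g) (volume.restrict (Icc (0:ℝ) 1)) := by
  have hH2 : IntegrableOn (fun s => (F s * G s)^2) (Icc (0:ℝ) 1) :=
    (by fun_prop : Continuous (fun s => (F s * G s)^2)).continuousOn.integrableOn_Icc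
  have hle : ∀ t s, ‖K t s * (F s * G s)‖ ≤ (K t s)^2 + (F s * G s)^2 := by
    intro t s
    rw [Real.norm_eq_abs, abs_mul]
    nlinarith [sq_abs (K t s), sq_abs (F s * G s), sq_nonneg (|K t s| - |F s * G s|),
      sq_nonneg (K t s), sq_nonneg (F s * G s)]
  have hKt : ∀ t, Measurable (fun s => K t s) := fun t => hKmeas.of_uncurry_left
  have hI : ∀ t ∈ Icc (0:ℝ) 1, IntegrableOn (fun s => K t s * (F s * G s)) (Icc 0 1) := by
    intro t ht
    refine Integrable.mono' ((hKint t ht).add hH2) ?_ (Filter.Eventually.of_forall (hle t))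
    exact ((hKt t).mul (hF.mul hG).measurable).aestronglyMeasurable
  have hsub : ∀ t ∈ Icc (0:ℝ) 1, Icc 0 t ⊆ Icc (0:ℝ) 1 := fun t ht => Icc_subset_Icc_right ht.2
  have heq : ∀ t ∈ Icc (0:ℝ) 1, EqOn (fun s => K t s * (F s * G s))
      (fun s => K t s * (f s * g s)) (Icc 0 t) := by
    intro t ht s hs
    simp only
    rw [hfF (hsub t ht hs), hgG (hsub t ht hs)]
  have hkeq : ∀ t ∈ Icc (0:ℝ) 1, Kop K F G t = Kop K f g t := by
    intro t ht
    exact setIntegral_congr_fun measurableSet_Icc (heq t ht)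
  refine ⟨?_, ⟨CK + ∫ s in Icc (0:ℝ) 1, (F s * G s)^2, ?_⟩, ?_⟩
  · intro t ht
    exact ((hI t ht).mono_set (hsub t ht)).congr_fun (heq t ht) measurableSet_Icc
  · intro t ht
    rw [← hkeq t ht, ← Real.norm_eq_abs]
    calc ‖Kop K F G t‖ ≤ ∫ s in Icc 0 t, ‖K t s * (F s * G s)‖ := norm_integral_le_integral_norm _
      _ ≤ ∫ s in Icc (0:ℝ) 1, ‖K t s * (F s * G s)‖ :=
        setIntegral_mono_set (hI t ht).norm
          (Filter.Eventually.of_forall fun s => norm_nonneg _) (hsub t ht).eventuallyLE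
      _ ≤ ∫ s in Icc (0:ℝ) 1, ((K t s)^2 + (F s * G s)^2) :=
        integral_mono (hI t ht).norm (Integrable.add (hKint t ht) hH2) (hle t)
      _ = (∫ s in Icc (0:ℝ) 1, (K t s)^2) + ∫ s in Icc (0:ℝ) 1, (F s * G s)^2 :=
        integral_add (hKint t ht) hH2
      _ ≤ _ := by gcongr; exact hKbdd t ht
  · have hm : StronglyMeasurable (Kop K F G) := by
      have : Kop K F G = fun t => ∫ s,
          {p : ℝ × ℝ | 0 ≤ p.2 ∧ p.2 ≤ p.1}.indicator
            (fun p => K p.1 p.2 * (F p.2 * G p.2)) (t, s) := by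
        funext t
        rw [Kop, ← integral_indicator measurableSet_Icc]
        rfl
      rw [this]
      refine StronglyMeasurable.integral_prod_right (Measurable.stronglyMeasurable ?_)
      refine Measurable.indicator ?_ ?_
      · exact (show Measurable fun p : ℝ × ℝ => K p.1 p.2 from hKmeas).mul
          ((hF.measurable.comp measurable_snd).mul (hG.measurable.comp measurable_snd))
      · exact (measurableSet_le measurable_const measurable_snd).inter
          (measurableSet_le measurable_snd measurable_fst)
    refine hm.aestronglyMeasurable.congr ?_
    exact (ae_restrict_iff' measurableSet_Icc).2 (Filter.Eventually.of_forall hkeq)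

lemma aux_core (σ : ℝ → ℝ) (hσ : ContDiff ℝ 1 σ) (A B C df dg : ℝ → ℝ) (M : ℝ)
    (μ : Measure ℝ)
    (hA : AEStronglyMeasurable A μ) (hB : AEStronglyMeasurable B μ)
    (hC : AEStronglyMeasurable C μ)
    (hdf : Integrable df μ) (hdg : Integrable dg μ)
    (hM : ∀ᵐ s ∂μ, |A s| ≤ M ∧ |B s| ≤ M ∧ |C s| ≤ M) :
    HasDerivAt (fun δ : ℝ => ∫ s, σ (A s + 2 * δ * B s + δ^2 * C s) * (df s + δ * dg s) ∂μ)
      ((∫ s, σ (A s) * dg s ∂μ) + 2 * ∫ s, deriv σ (A s) * df s * B s ∂μ) 0 := by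
  have hσc : Continuous σ := hσ.continuous
  have hσ' : Continuous (deriv σ) := hσ.continuous_deriv le_rfl
  obtain ⟨S₁, hS₁⟩ := (isCompact_Icc (a := -(4*M)) (b := 4*M)).exists_bound_of_continuousOn
    hσc.continuousOn
  obtain ⟨S₂, hS₂⟩ := (isCompact_Icc (a := -(4*M)) (b := 4*M)).exists_bound_of_continuousOn
    hσ'.continuousOn
  have harg : ∀ δ ∈ Metric.ball (0:ℝ) 1, ∀ a b c : ℝ, |a| ≤ M → |b| ≤ M → |c| ≤ M →
      a + 2 * δ * b + δ^2 * c ∈ Icc (-(4*M)) (4*M) ∧ |2 * b + 2 * δ * c| ≤ 4 * M := by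
    intro δ hδ a b c ha hb hc
    have hδ1 : |δ| ≤ 1 := by simpa [Real.dist_eq] using (Metric.mem_ball.1 hδ).le
    have hM0 : 0 ≤ M := (abs_nonneg a).trans ha
    have h1 : |δ * b| ≤ M := by
      rw [abs_mul]; nlinarith [abs_nonneg δ, abs_nonneg b]
    have h2 : |δ * c| ≤ M := by
      rw [abs_mul]; nlinarith [abs_nonneg δ, abs_nonneg c]
    have h3 : |δ * (δ * c)| ≤ M := by
      rw [abs_mul]; nlinarith [abs_nonneg δ, abs_nonneg (δ * c)]
    rw [abs_le] at *
    refine ⟨⟨?_, ?_⟩, ?_, ?_⟩ <;> nlinarith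
  have hargm : ∀ δ : ℝ, AEStronglyMeasurable (fun s => A s + 2 * δ * B s + δ^2 * C s) μ :=
    fun δ => (hA.add (hB.const_mul _)).add (hC.const_mul _)
  have hFm : ∀ δ : ℝ, AEStronglyMeasurable
      (fun s => σ (A s + 2 * δ * B s + δ^2 * C s) * (df s + δ * dg s)) μ := fun δ =>
    (hσc.comp_aestronglyMeasurable (hargm δ)).mul
      (hdf.aestronglyMeasurable.add (hdg.aestronglyMeasurable.const_mul _))
  have hm1 : AEStronglyMeasurable (fun s => σ (A s)) μ := hσc.comp_aestronglyMeasurable hA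
  have hm2 : AEStronglyMeasurable (fun s => deriv σ (A s)) μ := hσ'.comp_aestronglyMeasurable hA
  have h0 : (0:ℝ) ∈ Metric.ball (0:ℝ) 1 := by simp
  have hb1 : ∀ᵐ s ∂μ, ‖σ (A s)‖ ≤ S₁ := by
    filter_upwards [hM] with s hs
    have := (harg 0 h0 _ _ _ hs.1 hs.2.1 hs.2.2).1
    simpa using hS₁ _ this
  have hi1 : Integrable (fun s => σ (A s) * dg s) μ := hdg.bdd_mul hm1 hb1
  have hi1' : Integrable (fun s => σ (A s) * df s) μ := hdf.bdd_mul hm1 hb1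
  have hi2 : Integrable (fun s => deriv σ (A s) * df s * B s) μ := by
    refine (Integrable.mul_bdd (c := M) (hdf.bdd_mul (c := S₂) hm2 ?_) hB ?_)
    · filter_upwards [hM] with s hs
      have := (harg 0 h0 _ _ _ hs.1 hs.2.1 hs.2.2).1
      simpa using hS₂ _ this
    · filter_upwards [hM] with s hs using hs.2.1
  have key := hasDerivAt_integral_of_dominated_loc_of_deriv_le (μ := μ) (x₀ := (0:ℝ))
    (s := Metric.ball 0 1)
    (F := fun δ s => σ (A s + 2 * δ * B s + δ^2 * C s) * (df s + δ * dg s))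
    (F' := fun δ s => deriv σ (A s + 2 * δ * B s + δ^2 * C s) * (2 * B s + 2 * δ * C s)
        * (df s + δ * dg s) + σ (A s + 2 * δ * B s + δ^2 * C s) * dg s)
    (bound := fun s => S₂ * (4 * M) * (|df s| + |dg s|) + S₁ * |dg s|)
    (Metric.ball_mem_nhds _ one_pos)
    (Filter.Eventually.of_forall hFm) (by simpa using hi1')
    (by
      refine AEStronglyMeasurable.add (((hσ'.comp_aestronglyMeasurable (hargm 0)).mul
        ((hB.const_mul _).add (hC.const_mul _))).mul
        (hdf.aestronglyMeasurable.add (hdg.aestronglyMeasurable.const_mul _)))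
        ((hσc.comp_aestronglyMeasurable (hargm 0)).mul hdg.aestronglyMeasurable))
    (by
      filter_upwards [hM] with s hs δ hδ
      obtain ⟨h1, h2⟩ := harg δ hδ _ _ _ hs.1 hs.2.1 hs.2.2
      have hδ1 : |δ| ≤ 1 := by simpa [Real.dist_eq] using (Metric.mem_ball.1 hδ).le
      have h3 := hS₁ _ h1
      have h4 := hS₂ _ h1
      have h5 : |df s + δ * dg s| ≤ |df s| + |dg s| := by
        refine (abs_add_le _ _).trans ?_
        rw [abs_mul]
        nlinarith [abs_nonneg (dg s)]
      have hS₂0 : 0 ≤ S₂ := (norm_nonneg _).trans h4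
      have hM0 : 0 ≤ 4 * M := (abs_nonneg _).trans h2
      refine (norm_add_le _ _).trans ?_
      rw [norm_mul, norm_mul, norm_mul]
      simp only [Real.norm_eq_abs] at *
      gcongr)
    (((hdf.abs.add hdg.abs).const_mul _).add (hdg.abs.const_mul _))
    (by
      refine Filter.Eventually.of_forall fun s δ _ => ?_
      have ha : HasDerivAt (fun δ : ℝ => A s + 2 * δ * B s + δ^2 * C s)
          (2 * B s + 2 * δ * C s) δ := by
        have := ((((hasDerivAt_id' δ).const_mul 2).mul_const (B s)).const_add (A s)).add
          (((hasDerivAt_id' δ).pow 2).mul_const (C s))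
        refine this.congr_deriv ?_
        simp
      have hs : HasDerivAt σ _ (A s + 2 * δ * B s + δ^2 * C s) :=
        ((hσ.differentiable one_ne_zero) _).hasDerivAt
      have hd : HasDerivAt (fun δ : ℝ => df s + δ * dg s) (dg s) δ := by
        simpa using ((hasDerivAt_id δ).mul_const (dg s)).const_add (df s)
      exact (hs.comp δ ha).mul hd)
  refine key.2.congr_deriv (Eq.symm ?_)
  rw [← integral_const_mul, ← integral_add hi1 (hi2.const_mul 2)]
  congr 1
  funext s
  simp
  ring

/-- differentiability at `δ = 0` of
`δ ↦ ∫₀¹ σ(𝒦((f+δg)²)(s)) (ḟ(s) + δġ(s)) ds` for `f, g ∈ H₀¹[0,1]`, with derivative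
`∫₀¹ σ(𝒦(f²)(s)) ġ(s) ds + 2∫₀¹ σ′(𝒦(f²)(s)) ḟ(s) 𝒦(fg)(s) ds`. -/
theorem Gtilde_gateaux_derivative
    (K : ℝ → ℝ → ℝ) (c r : ℝ) (hc : 0 < c) (hr : 0 < r)
    (hKmeas : Measurable (Function.uncurry K))
    (hKint : ∀ t ∈ Icc (0:ℝ) 1, IntegrableOn (fun s => (K t s)^2) (Icc (0:ℝ) 1))
    (CK : ℝ) (hKbdd : ∀ t ∈ Icc (0:ℝ) 1, (∫ s in Icc (0:ℝ) 1, (K t s)^2) ≤ CK)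
    (hKmoc : ∀ t₁ ∈ Icc (0:ℝ) 1, ∀ t₂ ∈ Icc (0:ℝ) 1,
      (∫ s in Icc (0:ℝ) 1, (K t₁ s - K t₂ s)^2) ≤ c * |t₁ - t₂| ^ r)
    (hKvolterra : ∀ t s : ℝ, 0 ≤ t → t < s → s ≤ 1 → K t s = 0)
    (σ : ℝ → ℝ) (hσ : ContDiff ℝ 1 σ) (hσpos : ∀ x, 0 < σ x)
    -- f, g ∈ H₀¹[0,1], encoded by L² a.e. derivatives df, dg
    (f df g dg : ℝ → ℝ)
    (hdfmeas : Measurable df) (hdfL2 : IntegrableOn (fun s => (df s)^2) (Icc (0:ℝ) 1))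
    (hf : ∀ t ∈ Icc (0:ℝ) 1, f t = ∫ s in Icc (0:ℝ) t, df s)
    (hdgmeas : Measurable dg) (hdgL2 : IntegrableOn (fun s => (dg s)^2) (Icc (0:ℝ) 1))
    (hgrep : ∀ t ∈ Icc (0:ℝ) 1, g t = ∫ s in Icc (0:ℝ) t, dg s) :
    HasDerivAt
      (fun δ : ℝ => ∫ s in Icc (0:ℝ) 1,
        σ (Kop K (fun u => f u + δ * g u) (fun u => f u + δ * g u) s) * (df s + δ * dg s))
      ((∫ s in Icc (0:ℝ) 1, σ (Kop K f f s) * dg s) +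
        2 * ∫ s in Icc (0:ℝ) 1, deriv σ (Kop K f f s) * df s * Kop K f g s)
      0 := by
  obtain ⟨hdf, F, hF, hfF⟩ := aux_ext f df hdfmeas hdfL2 hf
  obtain ⟨hdg, G, hG, hgG⟩ := aux_ext g dg hdgmeas hdgL2 hgrep
  obtain ⟨hAi, ⟨MA, hMA⟩, hAm⟩ := aux_kop K hKmeas hKint CK hKbdd f f F F hF hF hfF hfF
  obtain ⟨hBi, ⟨MB, hMB⟩, hBm⟩ := aux_kop K hKmeas hKint CK hKbdd f g F G hF hG hfF hgG
  obtain ⟨hCi, ⟨MC, hMC⟩, hCm⟩ := aux_kop K hKmeas hKint CK hKbdd g g G G hG hG hgG hgG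
  have key := aux_core σ hσ (Kop K f f) (Kop K f g) (Kop K g g) df dg (max MA (max MB MC))
    (volume.restrict (Icc (0:ℝ) 1)) hAm hBm hCm hdf hdg
    ((ae_restrict_iff' measurableSet_Icc).2 (Filter.Eventually.of_forall fun s hs =>
      ⟨(hMA s hs).trans (le_max_left _ _),
       (hMB s hs).trans ((le_max_left _ _).trans (le_max_right _ _)),
       (hMC s hs).trans ((le_max_right _ _).trans (le_max_right _ _))⟩))
  convert key using 1
  funext δ
  refine setIntegral_congr_fun measurableSet_Icc fun t ht => ?_
  have : Kop K (fun u => f u + δ * g u) (fun u => f u + δ * g u) t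
      = Kop K f f t + 2 * δ * Kop K f g t + δ^2 * Kop K g g t := by
    have h1 := (hBi t ht).const_mul (2 * δ)
    have h2 := (hCi t ht).const_mul (δ^2)
    have e : (fun s => K t s * ((f s + δ * g s) * (f s + δ * g s))) = fun s =>
        (K t s * (f s * f s) + 2 * δ * (K t s * (f s * g s))) + δ^2 * (K t s * (g s * g s)) := by
      funext s; ring
    simp only [Kop]
    have h3 : Integrable (fun s => K t s * (f s * f s) + 2 * δ * (K t s * (f s * g s)))
        (volume.restrict (Icc 0 t)) := Integrable.add (hAi t ht) h1
    rw [e, integral_add h3 h2, integral_add (hAi t ht) h1,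
      integral_const_mul, integral_const_mul]
  simp only [this]
end
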